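/- Let p > 3 and q satisfy 3/p + 2/q = 1. There exists a constant C > 0 such that for every Schwartz function u₀ : ℝ² → ℂ, (∫_ℝ ‖U_φ(t)u₀‖_{L^q(ℝ²)}^p dt)^{1/p} ≤ C ‖u₀‖_{L²(ℝ²)}, where U_φ(t)u₀ = ℱ⁻¹(e^{−itφ(ξ,η)} ℱu₀) and φ(ξ,η) = ξ³ − 3ξη². -/

import Mathlib

open MeasureTheory

/-- The Fourier transform on `ℝ²`. -/
noncomputable def FT2 (f : ℝ × ℝ → ℂ) : ℝ × ℝ → ℂ :=
  fun w => ∫ v : ℝ × ℝ, Complex.exp (-Complex.I * (v.1 * w.1 + v.2 * w.2)) * f v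

/-- The phase function of the linearized Novikov-Veselov equation. -/
def phiNV (ξ η : ℝ) : ℝ := ξ ^ 3 - 3 * ξ * η ^ 2

/-- The free evolution `U_φ(t)u₀ = ℱ⁻¹(e^{−itφ} ℱu₀)` of the linearized
Novikov-Veselov equation. -/
noncomputable def Uphi (t : ℝ) (u₀ : ℝ × ℝ → ℂ) : ℝ × ℝ → ℂ :=
  fun v => (2 * Real.pi : ℂ)⁻¹ ^ 2 *
    ∫ w : ℝ × ℝ, Complex.exp (Complex.I * (v.1 * w.1 + v.2 * w.2)
      - Complex.I * t * phiNV w.1 w.2) * FT2 u₀ w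

/-- Van der Corput's first derivative test. -/
theorem norm_integral_cexp_le_of_deriv_ge {Φ Φ' Φ'' : ℝ → ℝ} {a b μ : ℝ} (hab : a ≤ b) (hμ : 0 < μ)
    (h1 : ∀ x ∈ Set.Icc a b, HasDerivAt Φ (Φ' x) x)
    (h2 : ∀ x ∈ Set.Icc a b, HasDerivAt Φ' (Φ'' x) x)
    (hc : ContinuousOn Φ'' (Set.Icc a b)) (hnn : ∀ x ∈ Set.Icc a b, 0 ≤ Φ'' x)
    (hlow : ∀ x ∈ Set.Icc a b, μ ≤ Φ' x) :
    ‖∫ x in a..b, Complex.exp (Complex.I * Φ x)‖ ≤ 2 / μ := by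
  have hpos : ∀ x ∈ Set.Icc a b, 0 < Φ' x := fun x hx => hμ.trans_le (hlow x hx)
  have cΦ : ContinuousOn Φ (Set.Icc a b) := fun x hx => (h1 x hx).continuousAt.continuousWithinAt
  have cΦ' : ContinuousOn Φ' (Set.Icc a b) := fun x hx => (h2 x hx).continuousAt.continuousWithinAt
  have ha : a ∈ Set.Icc a b := ⟨le_rfl, hab⟩
  have hb : b ∈ Set.Icc a b := ⟨hab, le_rfl⟩
  have cE : ContinuousOn (fun x => Complex.exp (Complex.I * Φ x)) (Set.Icc a b) := by fun_prop
  have cQ : ContinuousOn (fun x => Φ'' x / Φ' x ^ 2) (Set.Icc a b) :=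
    hc.div (cΦ'.pow 2) (fun x hx => (pow_pos (hpos x hx) 2).ne')
  have cR : ContinuousOn (fun x => Complex.exp (Complex.I * Φ x) * (Complex.I * ↑(Φ'' x / Φ' x ^ 2)))
      (Set.Icc a b) := cE.mul (continuousOn_const.mul (Complex.continuous_ofReal.comp_continuousOn cQ))
  have iE := cE.intervalIntegrable_of_Icc (μ := volume) hab
  have iQ := cQ.intervalIntegrable_of_Icc (μ := volume) hab
  have iR := cR.intervalIntegrable_of_Icc (μ := volume) hab
  have key : ∫ x in a..b, (Complex.exp (Complex.I * Φ x)
      + Complex.exp (Complex.I * Φ x) * (Complex.I * ↑(Φ'' x / Φ' x ^ 2)))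
      = -Complex.I * (Complex.exp (Complex.I * Φ b) * ((Φ' b)⁻¹ : ℝ))
        - -Complex.I * (Complex.exp (Complex.I * Φ a) * ((Φ' a)⁻¹ : ℝ)) := by
    refine intervalIntegral.integral_eq_sub_of_hasDerivAt
      (f := fun x => -Complex.I * (Complex.exp (Complex.I * Φ x) * ((Φ' x)⁻¹ : ℝ))) ?_ (iE.add iR)
    intro x hx
    rw [Set.uIcc_of_le hab] at hx
    have e1 := (((h1 x hx).ofReal_comp).const_mul Complex.I).cexp
    have e2 := ((h2 x hx).inv (hpos x hx).ne').ofReal_comp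
    refine ((e1.mul e2).const_mul (-Complex.I)).congr_deriv ?_
    have : (Φ' x : ℂ) ≠ 0 := by exact_mod_cast (hpos x hx).ne'
    simp only [Pi.inv_apply]
    push_cast
    field_simp
    ring_nf
    simp only [Complex.I_sq]
    ring
  have kQ : ∫ x in a..b, Φ'' x / Φ' x ^ 2 = -(Φ' b)⁻¹ - -(Φ' a)⁻¹ := by
    refine intervalIntegral.integral_eq_sub_of_hasDerivAt (f := fun x => -(Φ' x)⁻¹) ?_ iQ
    intro x hx
    rw [Set.uIcc_of_le hab] at hx
    exact ((h2 x hx).inv (hpos x hx).ne').neg.congr_deriv (by ring)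
  rw [intervalIntegral.integral_add iE iR] at key
  have nR : ‖∫ x in a..b, Complex.exp (Complex.I * Φ x) * (Complex.I * ↑(Φ'' x / Φ' x ^ 2))‖
      ≤ (Φ' a)⁻¹ - (Φ' b)⁻¹ := by
    refine (intervalIntegral.norm_integral_le_of_norm_le hab ?_ iQ).trans_eq (by rw [kQ]; ring)
    refine Filter.Eventually.of_forall fun x hx => ?_
    have hx' : x ∈ Set.Icc a b := ⟨hx.1.le, hx.2⟩
    rw [norm_mul, mul_comm Complex.I, mul_comm Complex.I, Complex.norm_exp_ofReal_mul_I, norm_mul,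
      Complex.norm_I, Complex.norm_real, Real.norm_of_nonneg]
    · simp
    · exact div_nonneg (hnn x hx') (sq_nonneg _)
  have nE : ∀ x ∈ Set.Icc a b,
      ‖-Complex.I * (Complex.exp (Complex.I * Φ x) * ((Φ' x)⁻¹ : ℝ))‖ = (Φ' x)⁻¹ := by
    intro x hx
    rw [norm_mul, norm_mul, mul_comm Complex.I, Complex.norm_exp_ofReal_mul_I, Complex.norm_real,
      Real.norm_of_nonneg (inv_nonneg.2 (hpos x hx).le)]
    simp
  rw [eq_sub_of_add_eq key]
  refine (norm_sub_le _ _).trans ?_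
  have := norm_sub_le (-Complex.I * (Complex.exp (Complex.I * Φ b) * ((Φ' b)⁻¹ : ℝ)))
    (-Complex.I * (Complex.exp (Complex.I * Φ a) * ((Φ' a)⁻¹ : ℝ)))
  rw [nE a ha, nE b hb] at this
  have h3 : (Φ' a)⁻¹ ≤ μ⁻¹ := inv_anti₀ hμ (hlow a ha)
  rw [div_eq_mul_inv]
  linarith

theorem norm_integral_cexp_le_of_deriv_nonneg {Φ Φ' Φ'' : ℝ → ℝ} {a b l : ℝ} (hab : a ≤ b)
    (hl : 0 < l)
    (h1 : ∀ x ∈ Set.Icc a b, HasDerivAt Φ (Φ' x) x)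
    (h2 : ∀ x ∈ Set.Icc a b, HasDerivAt Φ' (Φ'' x) x)
    (hc : ContinuousOn Φ'' (Set.Icc a b)) (hlow : ∀ x ∈ Set.Icc a b, l ≤ Φ'' x)
    (ha : 0 ≤ Φ' a) :
    ‖∫ x in a..b, Complex.exp (Complex.I * Φ x)‖ ≤ 3 / √l := by
  have hs : 0 < √l := Real.sqrt_pos.2 hl
  have triv : ∀ c, a ≤ c → ‖∫ x in a..c, Complex.exp (Complex.I * Φ x)‖ ≤ c - a := by
    intro c hac
    refine (intervalIntegral.norm_integral_le_of_norm_le_const (C := 1) ?_).trans ?_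
    · intro x _
      rw [mul_comm, Complex.norm_exp_ofReal_mul_I]
    · rw [abs_of_nonneg (by linarith)]; simp
  by_cases hba : b - a ≤ 1 / √l
  · refine (triv b hab).trans (hba.trans ?_)
    gcongr; norm_num
  · push Not at hba
    set c := a + 1 / √l with hcdef
    have hac : a ≤ c := by have := div_pos one_pos hs; linarith
    have hcb : c ≤ b := by linarith
    have sub : Set.Icc c b ⊆ Set.Icc a b := Set.Icc_subset_Icc_left hac
    have hgrow : ∀ x ∈ Set.Icc a b, l * (x - a) ≤ Φ' x := by
      intro x hx
      have hsub : Set.Icc a x ⊆ Set.Icc a b := Set.Icc_subset_Icc_right hx.2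
      have := (convex_Icc a x).mul_sub_le_image_sub_of_le_deriv (f := Φ') (C := l)
        (fun y hy => (h2 y (hsub hy)).continuousAt.continuousWithinAt)
        (fun y hy => (h2 y (hsub (interior_subset hy))).differentiableAt.differentiableWithinAt)
        (fun y hy => by rw [(h2 y (hsub (interior_subset hy))).deriv]; exact hlow y (hsub (interior_subset hy)))
        a ⟨le_rfl, hx.1⟩ x ⟨hx.1, le_rfl⟩ hx.1
      linarith
    have hl2 : l * (1 / √l) = √l := by
      rw [mul_one_div, Real.div_sqrt]
    have h3 := norm_integral_cexp_le_of_deriv_ge (μ := √l) hcb hs (fun x hx => h1 x (sub hx))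
      (fun x hx => h2 x (sub hx)) (hc.mono sub) (fun x hx => hl.le.trans (hlow x (sub hx)))
      (fun x hx => by
        refine le_trans ?_ (hgrow x (sub hx))
        rw [← hl2]
        have := hx.1
        gcongr
        linarith)
    have cE : ContinuousOn (fun x => Complex.exp (Complex.I * Φ x)) (Set.Icc a b) := by
      have : ContinuousOn Φ (Set.Icc a b) := fun x hx => (h1 x hx).continuousAt.continuousWithinAt
      fun_prop
    rw [← intervalIntegral.integral_add_adjacent_intervals
      ((cE.mono (Set.Icc_subset_Icc_right hcb)).intervalIntegrable_of_Icc hac)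
      ((cE.mono sub).intervalIntegrable_of_Icc hcb)]
    refine (norm_add_le _ _).trans ((add_le_add (triv c hac) h3).trans_eq ?_)
    rw [hcdef]; ring

theorem norm_integral_cexp_le {Φ Φ' Φ'' : ℝ → ℝ} {a b l : ℝ} (hab : a ≤ b) (hl : 0 < l)
    (h1 : ∀ x ∈ Set.Icc a b, HasDerivAt Φ (Φ' x) x)
    (h2 : ∀ x ∈ Set.Icc a b, HasDerivAt Φ' (Φ'' x) x)
    (hc : ContinuousOn Φ'' (Set.Icc a b)) (hlow : ∀ x ∈ Set.Icc a b, l ≤ Φ'' x) :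
    ‖∫ x in a..b, Complex.exp (Complex.I * Φ x)‖ ≤ 6 / √l := by
  have hs : 0 < √l := Real.sqrt_pos.2 hl
  have h36 : 3 / √l ≤ 6 / √l := by gcongr; norm_num
  have neg : ∀ c, a ≤ c → c ≤ b → Φ' c ≤ 0 →
      ‖∫ x in a..c, Complex.exp (Complex.I * Φ x)‖ ≤ 3 / √l := by
    intro c hac hcb hneg
    have mem : ∀ x ∈ Set.Icc (-c) (-a), -x ∈ Set.Icc a b := fun x hx =>
      ⟨by linarith [hx.2], by linarith [hx.1]⟩
    have := norm_integral_cexp_le_of_deriv_nonneg (Φ := fun x => Φ (-x)) (Φ' := fun x => -Φ' (-x))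
      (Φ'' := fun x => Φ'' (-x)) (a := -c) (b := -a) (l := l) (by linarith) hl
      (fun x hx => by
        exact ((h1 (-x) (mem x hx)).scomp x (hasDerivAt_neg x)).congr_deriv (by simp))
      (fun x hx => by
        exact ((h2 (-x) (mem x hx)).scomp x (hasDerivAt_neg x)).neg.congr_deriv (by simp))
      (hc.comp continuous_neg.continuousOn mem) (fun x hx => hlow _ (mem x hx)) (by simpa using hneg)
    rwa [intervalIntegral.integral_comp_neg (f := fun x => Complex.exp (Complex.I * Φ x)),
      neg_neg, neg_neg] at this
  have pos : ∀ c, a ≤ c → c ≤ b → 0 ≤ Φ' c →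
      ‖∫ x in c..b, Complex.exp (Complex.I * Φ x)‖ ≤ 3 / √l := by
    intro c hac hcb hnn
    have sub : Set.Icc c b ⊆ Set.Icc a b := Set.Icc_subset_Icc_left hac
    exact norm_integral_cexp_le_of_deriv_nonneg hcb hl (fun x hx => h1 x (sub hx))
      (fun x hx => h2 x (sub hx)) (hc.mono sub) (fun x hx => hlow x (sub hx)) hnn
  rcases le_or_gt 0 (Φ' a) with h | h
  · exact (pos a le_rfl hab h).trans h36
  rcases le_or_gt (Φ' b) 0 with h' | h'
  · exact (neg b hab le_rfl h').trans h36
  obtain ⟨c, ⟨hac, hcb⟩, h0⟩ := intermediate_value_Icc hab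
    (fun x hx => (h2 x hx).continuousAt.continuousWithinAt) (show (0:ℝ) ∈ Set.Icc (Φ' a) (Φ' b) from
      ⟨h.le, h'.le⟩)
  have cE : ContinuousOn (fun x => Complex.exp (Complex.I * Φ x)) (Set.Icc a b) := by
    have : ContinuousOn Φ (Set.Icc a b) := fun x hx => (h1 x hx).continuousAt.continuousWithinAt
    fun_prop
  rw [← intervalIntegral.integral_add_adjacent_intervals
    ((cE.mono (Set.Icc_subset_Icc_right hcb)).intervalIntegrable_of_Icc hac)
    ((cE.mono (Set.Icc_subset_Icc_left hac)).intervalIntegrable_of_Icc hcb)]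
  refine (norm_add_le _ _).trans ((add_le_add (neg c hac hcb h0.le) (pos c hac hcb h0.ge)).trans_eq ?_)
  ring

/-- Van der Corput's second derivative test, with an amplitude. -/
theorem norm_integral_mul_cexp_le {Φ Φ' Φ'' ψ ψ' : ℝ → ℝ} {a b l V : ℝ} (hab : a ≤ b) (hl : 0 < l)
    (h1 : ∀ x ∈ Set.Icc a b, HasDerivAt Φ (Φ' x) x)
    (h2 : ∀ x ∈ Set.Icc a b, HasDerivAt Φ' (Φ'' x) x)
    (hc : ContinuousOn Φ'' (Set.Icc a b)) (hlow : ∀ x ∈ Set.Icc a b, l ≤ Φ'' x)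
    (hψ : ∀ x ∈ Set.Icc a b, HasDerivAt ψ (ψ' x) x) (hψc : ContinuousOn ψ' (Set.Icc a b))
    (hV : |ψ b| + ∫ x in a..b, |ψ' x| ≤ V) :
    ‖∫ x in a..b, (ψ x : ℂ) * Complex.exp (Complex.I * Φ x)‖ ≤ 6 / √l * V := by
  have hs : 0 < √l := Real.sqrt_pos.2 hl
  set E : ℝ → ℂ := fun x => Complex.exp (Complex.I * Φ (Set.projIcc a b hab x)) with hE
  have cΦ : ContinuousOn Φ (Set.Icc a b) := fun x hx => (h1 x hx).continuousAt.continuousWithinAt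
  have cE : Continuous E := by
    have : Continuous fun x => Φ (Set.projIcc a b hab x) :=
      cΦ.comp_continuous (by fun_prop) (fun x => Subtype.coe_prop _)
    exact Complex.continuous_exp.comp
      (continuous_const.mul (Complex.continuous_ofReal.comp this))
  have EE : ∀ x ∈ Set.Icc a b, E x = Complex.exp (Complex.I * Φ x) := fun x hx => by
    simp only [hE, Set.projIcc_of_mem hab hx]
  have bound : ∀ x ∈ Set.Icc a b, ‖∫ y in a..x, E y‖ ≤ 6 / √l := by
    intro x hx
    have sub : Set.Icc a x ⊆ Set.Icc a b := Set.Icc_subset_Icc_right hx.2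
    rw [intervalIntegral.integral_congr (g := fun x => Complex.exp (Complex.I * Φ x))
      (fun y hy => by rw [Set.uIcc_of_le hx.1] at hy; exact EE y (sub hy))]
    exact norm_integral_cexp_le hx.1 hl (fun x hx => h1 x (sub hx))
      (fun x hx => h2 x (sub hx)) (hc.mono sub) (fun x hx => hlow x (sub hx))
  have ibp := intervalIntegral.integral_mul_deriv_eq_deriv_mul (a := a) (b := b)
    (u := fun x => (ψ x : ℂ)) (v := fun x => ∫ y in a..x, E y) (u' := fun x => (ψ' x : ℂ)) (v' := E)
    (fun x hx => (hψ x (by rwa [Set.uIcc_of_le hab] at hx)).ofReal_comp)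
    (fun x _ => cE.integral_hasStrictDerivAt a x |>.hasDerivAt)
    ((Complex.continuous_ofReal.comp_continuousOn hψc).intervalIntegrable_of_Icc hab)
    (cE.intervalIntegrable _ _)
  rw [intervalIntegral.integral_congr (g := fun x => (ψ x : ℂ) * E x)
      (fun y hy => by rw [Set.uIcc_of_le hab] at hy; simp only [EE y hy]), ibp]
  simp only [intervalIntegral.integral_same, mul_zero, sub_zero]
  have hb : b ∈ Set.Icc a b := ⟨hab, le_rfl⟩
  have n1 : ‖(ψ b : ℂ) * ∫ y in a..b, E y‖ ≤ |ψ b| * (6 / √l) := by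
    rw [norm_mul, Complex.norm_real, Real.norm_eq_abs]
    gcongr
    exact bound b hb
  have n2 : ‖∫ x in a..b, (ψ' x : ℂ) * ∫ y in a..x, E y‖ ≤ (∫ x in a..b, |ψ' x|) * (6 / √l) := by
    rw [← intervalIntegral.integral_mul_const]
    refine intervalIntegral.norm_integral_le_of_norm_le hab ?_ ?_
    · refine Filter.Eventually.of_forall fun x hx => ?_
      rw [norm_mul, Complex.norm_real, Real.norm_eq_abs]
      gcongr
      exact bound x ⟨hx.1.le, hx.2⟩
    · exact (hψc.abs.mul continuousOn_const).intervalIntegrable_of_Icc hab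
  refine (norm_sub_le _ _).trans ((add_le_add n1 n2).trans ?_)
  rw [← add_mul, mul_comm]
  gcongr

theorem norm_integral_rpow_mul_cexp_le {s c d x R : ℝ} (hs : 0 < s) (hc : 0 ≤ c) (hd : 0 ≤ d)
    (hR : 0 ≤ R) :
    ‖∫ ξ in (0 : ℝ)..R, ((ξ ^ (-(1 / 2) : ℝ) * Real.exp (-d / ξ) : ℝ) : ℂ)
      * Complex.exp (Complex.I * (x * ξ + s ^ 6 * ξ ^ 3 + c / ξ : ℝ))‖ ≤ 14 / s := by
  set f : ℝ → ℂ := fun ξ => ((ξ ^ (-(1 / 2) : ℝ) * Real.exp (-d / ξ) : ℝ) : ℂ)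
      * Complex.exp (Complex.I * (x * ξ + s ^ 6 * ξ ^ 3 + c / ξ : ℝ)) with hf
  have fn : ∀ ξ, 0 < ξ → ‖f ξ‖ ≤ ξ ^ (-(1 / 2) : ℝ) := by
    intro ξ hξ
    simp only [hf]
    rw [norm_mul, mul_comm Complex.I, Complex.norm_exp_ofReal_mul_I, Complex.norm_real,
      Real.norm_of_nonneg (by positivity), mul_one]
    apply mul_le_of_le_one_right (by positivity)
    rw [Real.exp_le_one_iff]
    exact div_nonpos_of_nonpos_of_nonneg (by linarith) hξ.le
  have fm : Measurable f := by
    simp only [hf]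
    fun_prop
  have fi : ∀ u v, 0 ≤ u → u ≤ v → IntervalIntegrable f volume u v := by
    intro u v hu huv
    refine (intervalIntegral.intervalIntegrable_rpow' (r := -(1 / 2)) (by norm_num)).mono_fun
      fm.aestronglyMeasurable ?_
    rw [Set.uIoc_of_le huv]
    refine (ae_restrict_mem measurableSet_Ioc).mono fun ξ hξ => ?_
    have hξ0 := hu.trans_lt hξ.1
    exact (fn ξ hξ0).trans (le_abs_self _)
  have near : ∀ u, 0 ≤ u → u ≤ (s ^ 2)⁻¹ → ‖∫ ξ in (0 : ℝ)..u, f ξ‖ ≤ 2 / s := by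
    intro u hu hua
    refine (intervalIntegral.norm_integral_le_of_norm_le hu
      (Filter.Eventually.of_forall fun ξ hξ => fn ξ hξ.1)
      (intervalIntegral.intervalIntegrable_rpow' (by norm_num))).trans ?_
    rw [integral_rpow (Or.inl (by norm_num)), Real.zero_rpow (by norm_num)]
    have : u ^ (1 / 2 : ℝ) ≤ s⁻¹ := by
      rw [← Real.sqrt_eq_rpow]
      refine (Real.sqrt_le_sqrt hua).trans_eq ?_
      rw [← inv_pow, Real.sqrt_sq (by positivity)]
    rw [show (-(1 / 2) + 1 : ℝ) = 1 / 2 by norm_num, sub_zero, div_div_eq_mul_div, div_one,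
      div_eq_mul_inv 2 s]
    linarith
  have h214 : 2 / s ≤ 14 / s := by gcongr; norm_num
  rcases le_or_gt R (s ^ 2)⁻¹ with h | h
  · exact (near R hR h).trans h214
  set a := (s ^ 2)⁻¹ with ha
  have ha0 : 0 < a := by positivity
  have pos : ∀ ξ ∈ Set.Icc a R, 0 < ξ := fun ξ hξ => ha0.trans_le hξ.1
  have ahalf : a ^ (-(1 / 2) : ℝ) = s := by
    rw [Real.rpow_neg ha0.le, ← Real.sqrt_eq_rpow, ha, ← inv_pow, Real.sqrt_sq (by positivity),
      inv_inv]
  have dexp : ∀ ξ, 0 < ξ → HasDerivAt (fun ξ => Real.exp (-d / ξ))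
      (Real.exp (-d / ξ) * (d / ξ ^ 2)) ξ := by
    intro ξ hξ
    have h := (((hasDerivAt_inv hξ.ne').const_mul (-d))).exp
    simp only [← div_eq_mul_inv] at h
    exact h.congr_deriv (by field_simp)
  have dpow : ∀ ξ : ℝ, 0 < ξ → HasDerivAt (fun ξ : ℝ => ξ ^ (-(1 / 2) : ℝ))
      (-(1 / 2) * ξ ^ (-(3 / 2) : ℝ)) ξ := by
    intro ξ hξ
    exact (Real.hasDerivAt_rpow_const (Or.inl hξ.ne')).congr_deriv (by norm_num)
  have cinv : ∀ k : ℝ, ContinuousOn (fun ξ : ℝ => k / ξ) (Set.Icc a R) := fun k =>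
    continuousOn_const.div continuousOn_id fun ξ hξ => (pos ξ hξ).ne'
  have cinv2 : ∀ (k : ℝ) (j : ℕ), ContinuousOn (fun ξ : ℝ => k / ξ ^ j) (Set.Icc a R) := fun k j =>
    continuousOn_const.div (continuousOn_id.pow j) fun ξ hξ => (pow_pos (pos ξ hξ) j).ne'
  have cpow : ∀ r : ℝ, ContinuousOn (fun ξ : ℝ => ξ ^ r) (Set.Icc a R) := fun r =>
    continuousOn_id.rpow_const fun ξ hξ => Or.inl (pos ξ hξ).ne'
  have cexp' : ContinuousOn (fun ξ : ℝ => Real.exp (-d / ξ)) (Set.Icc a R) :=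
    Real.continuous_exp.comp_continuousOn (cinv _)
  have main := norm_integral_mul_cexp_le (a := a) (b := R) (l := s ^ 4) (V := 2 * s)
    (Φ := fun ξ => x * ξ + s ^ 6 * ξ ^ 3 + c / ξ)
    (Φ' := fun ξ => x + s ^ 6 * (3 * ξ ^ 2) - c / ξ ^ 2)
    (Φ'' := fun ξ => s ^ 6 * (6 * ξ) + 2 * c / ξ ^ 3)
    (ψ := fun ξ => ξ ^ (-(1 / 2) : ℝ) * Real.exp (-d / ξ))
    (ψ' := fun ξ => -(1 / 2) * ξ ^ (-(3 / 2) : ℝ) * Real.exp (-d / ξ)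
      + ξ ^ (-(1 / 2) : ℝ) * (Real.exp (-d / ξ) * (d / ξ ^ 2)))
    h.le (by positivity)
    (fun ξ hξ => by
      have hξ := pos ξ hξ
      have h := (((hasDerivAt_id ξ).const_mul x).add ((hasDerivAt_pow 3 ξ).const_mul (s ^ 6))).add
        ((hasDerivAt_inv hξ.ne').const_mul c)
      refine h.congr_deriv ?_
      simp; ring)
    (fun ξ hξ => by
      have hξ := pos ξ hξ
      have h := (((hasDerivAt_pow 2 ξ).const_mul 3).const_mul (s ^ 6)).const_add x |>.sub
        (((hasDerivAt_pow 2 ξ).inv (pow_pos hξ 2).ne').const_mul c)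
      refine h.congr_deriv ?_
      simp; field_simp; ring)
    ((by fun_prop : Continuous fun ξ : ℝ => s ^ 6 * (6 * ξ)).continuousOn.add (cinv2 _ 3))
    (fun ξ hξ => by
      have hξ' := pos ξ hξ
      have h1 : s ^ 6 * (6 * a) = 6 * s ^ 4 := by rw [ha]; field_simp
      have h2 : s ^ 6 * (6 * a) ≤ s ^ 6 * (6 * ξ) := by have := hξ.1; gcongr
      have h3 : 0 ≤ 2 * c / ξ ^ 3 := by positivity
      have h4 : 0 < s ^ 4 := by positivity
      linarith)
    (fun ξ hξ => (dpow ξ (pos ξ hξ)).mul (dexp ξ (pos ξ hξ)))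
    (((continuousOn_const.mul (cpow _)).mul cexp').add ((cpow _).mul (cexp'.mul (cinv2 _ 2))))
    (by
      have key : ∫ ξ in a..R, (1 / 2 * ξ ^ (-(3 / 2) : ℝ) + s * (Real.exp (-d / ξ) * (d / ξ ^ 2)))
          = (-R ^ (-(1 / 2) : ℝ) + s * Real.exp (-d / R))
            - (-a ^ (-(1 / 2) : ℝ) + s * Real.exp (-d / a)) := by
        refine intervalIntegral.integral_eq_sub_of_hasDerivAt
          (f := fun ξ : ℝ => -ξ ^ (-(1 / 2) : ℝ) + s * Real.exp (-d / ξ)) ?_ ?_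
        · intro ξ hξ
          rw [Set.uIcc_of_le h.le] at hξ
          exact ((dpow ξ (pos ξ hξ)).neg.add ((dexp ξ (pos ξ hξ)).const_mul s)).congr_deriv
            (by ring)
        · exact ((continuousOn_const.mul (cpow _)).add
            (continuousOn_const.mul (cexp'.mul (cinv2 _ 2)))).intervalIntegrable_of_Icc h.le
      have le : ∫ ξ in a..R, |-(1 / 2) * ξ ^ (-(3 / 2) : ℝ) * Real.exp (-d / ξ)
          + ξ ^ (-(1 / 2) : ℝ) * (Real.exp (-d / ξ) * (d / ξ ^ 2))|
          ≤ ∫ ξ in a..R, (1 / 2 * ξ ^ (-(3 / 2) : ℝ) + s * (Real.exp (-d / ξ) * (d / ξ ^ 2))) := by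
        refine intervalIntegral.integral_mono_on h.le ?_ ?_ ?_
        · exact (((continuousOn_const.mul (cpow _)).mul cexp').add
            ((cpow _).mul (cexp'.mul (cinv2 _ 2)))).abs.intervalIntegrable_of_Icc h.le
        · exact ((continuousOn_const.mul (cpow _)).add
            (continuousOn_const.mul (cexp'.mul (cinv2 _ 2)))).intervalIntegrable_of_Icc h.le
        · intro ξ hξ
          have hξ' := pos ξ hξ
          have e1 : Real.exp (-d / ξ) ≤ 1 := by
            rw [Real.exp_le_one_iff]
            exact div_nonpos_of_nonpos_of_nonneg (by linarith) hξ'.le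
          have e2 : ξ ^ (-(1 / 2) : ℝ) ≤ s := by
            rw [← ahalf]
            exact Real.rpow_le_rpow_of_nonpos ha0 hξ.1 (by norm_num)
          refine (abs_add_le _ _).trans (add_le_add ?_ ?_)
          · rw [abs_mul, abs_mul, abs_of_nonneg (Real.exp_nonneg _),
              abs_of_nonneg (Real.rpow_nonneg hξ'.le _)]
            norm_num
            exact mul_le_of_le_one_right (by positivity) e1
          · rw [abs_of_nonneg (by positivity)]
            gcongr
      have hR0 := pos R ⟨h.le, le_rfl⟩
      have e1 : Real.exp (-d / R) ≤ 1 := by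
        rw [Real.exp_le_one_iff]
        exact div_nonpos_of_nonpos_of_nonneg (by linarith) hR0.le
      have e2 := mul_le_mul_of_nonneg_left e1 hs.le
      have e3 := mul_le_mul_of_nonneg_left e1 (Real.rpow_nonneg hR0.le (-(1 / 2)))
      have e4 : 0 ≤ s * Real.exp (-d / a) := by positivity
      rw [abs_of_nonneg (by positivity)]
      rw [key, ahalf] at le
      linarith)
  rw [← intervalIntegral.integral_add_adjacent_intervals (fi 0 a le_rfl ha0.le)
    (fi a R ha0.le h.le)]
  refine (norm_add_le _ _).trans ((add_le_add (near a ha0.le le_rfl) main).trans_eq ?_)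
  rw [show s ^ 4 = (s ^ 2) ^ 2 by ring, Real.sqrt_sq (by positivity)]
  field_simp
  ring

theorem norm_integral_rpow_mul_cexp_le_abs {τ c d x R : ℝ} (hτ : τ ≠ 0) (hc : 0 ≤ τ * c)
    (hd : 0 ≤ d) (hR : 0 ≤ R) :
    ‖∫ ξ in (0 : ℝ)..R, ((ξ ^ (-(1 / 2) : ℝ) * Real.exp (-d / ξ) : ℝ) : ℂ)
      * Complex.exp (Complex.I * (x * ξ + τ * ξ ^ 3 + c / ξ : ℝ))‖ ≤ 14 * |τ| ^ (-(1 / 6) : ℝ) := by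
  have hτ' := abs_pos.2 hτ
  set s := |τ| ^ (1 / 6 : ℝ) with hs
  have hs0 : 0 < s := Real.rpow_pos_of_pos hτ' _
  have hs6 : s ^ 6 = |τ| := by
    rw [hs, ← Real.rpow_natCast, ← Real.rpow_mul hτ'.le]; norm_num
  rw [Real.rpow_neg hτ'.le, ← hs, ← div_eq_mul_inv]
  rcases lt_or_gt_of_ne hτ with h | h
  · rw [abs_of_neg h] at hs6
    have := norm_integral_rpow_mul_cexp_le (x := -x) hs0
      (show 0 ≤ -c from by by_contra hh; nlinarith) hd hR
    rw [← Complex.norm_conj, intervalIntegral.integral_of_le hR, ← integral_conj,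
      ← intervalIntegral.integral_of_le hR] at this
    refine (congrArg norm (intervalIntegral.integral_congr fun ξ _ => ?_)).trans_le this
    rw [map_mul, Complex.conj_ofReal, ← Complex.exp_conj, map_mul, Complex.conj_I,
      Complex.conj_ofReal, hs6]
    congr 2
    push_cast
    ring
  · rw [abs_of_pos h] at hs6
    have := norm_integral_rpow_mul_cexp_le (x := x) hs0
      (show 0 ≤ c from by by_contra hh; nlinarith) hd hR
    rwa [hs6] at this

theorem Complex.ofReal_mul_cpow_of_pos {r : ℝ} (hr : 0 < r) {w : ℂ} (hw : w ≠ 0) (s : ℂ) :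
    (r * w) ^ s = (r : ℂ) ^ s * w ^ s := by
  have hr' : (r : ℂ) ≠ 0 := by exact_mod_cast hr.ne'
  rw [Complex.cpow_def_of_ne_zero (mul_ne_zero hr' hw), Complex.cpow_def_of_ne_zero hr',
    Complex.cpow_def_of_ne_zero hw, Complex.log_ofReal_mul hr hw, Complex.ofReal_log hr.le,
    ← Complex.exp_add]
  ring_nf

theorem norm_integral_Ioi_gaussian_fiber_le {ε τ x y R : ℝ} (hε : 0 < ε) (hτ : τ ≠ 0) (hR : 0 ≤ R) :
    ‖∫ ξ in Set.Ioi (0 : ℝ), (Set.Iic R).indicator (fun ξ : ℝ =>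
      Complex.exp (Complex.I * (x * ξ + τ * ξ ^ 3 : ℝ)) *
        ∫ η : ℝ, Complex.exp (Complex.I * y * η)
          * Complex.exp (-((ε + 3 * τ * Complex.I) * ξ) * η ^ 2)) ξ‖
      ≤ 28 * |τ| ^ (-(2 / 3) : ℝ) := by
  set z : ℂ := ε + 3 * τ * Complex.I with hz
  have hτ' := abs_pos.2 hτ
  have hzre : z.re = ε := by simp [hz]
  have hzim : z.im = 3 * τ := by simp [hz]
  have hz0 : z ≠ 0 := fun h => hε.ne' (by rw [← hzre, h]; rfl)
  set N := ε ^ 2 + 9 * τ ^ 2 with hN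
  have hN0 : 0 < N := by positivity
  set d := y ^ 2 * ε / (4 * N) with hd
  set c := 3 * τ * y ^ 2 / (4 * N) with hc
  set A : ℂ := (Real.pi / z) ^ (1 / 2 : ℂ) with hA
  have inner : ∀ ξ : ℝ, 0 < ξ → Complex.exp (Complex.I * (x * ξ + τ * ξ ^ 3 : ℝ)) *
        ∫ η : ℝ, Complex.exp (Complex.I * y * η) * Complex.exp (-(z * ξ) * η ^ 2)
      = A * (((ξ ^ (-(1 / 2) : ℝ) * Real.exp (-d / ξ) : ℝ) : ℂ)
      * Complex.exp (Complex.I * (x * ξ + τ * ξ ^ 3 + c / ξ : ℝ))) := by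
    intro ξ hξ
    have hξ' : (ξ : ℂ) ≠ 0 := by exact_mod_cast hξ.ne'
    rw [fourierIntegral_gaussian (by simp [hzre]; positivity)]
    have e1 : (Real.pi / (z * ξ) : ℂ) = ((ξ⁻¹ : ℝ) : ℂ) * (Real.pi / z) := by
      push_cast; field_simp
    have e2 : (ξ ^ (-(1 / 2) : ℝ) : ℝ) = (((ξ⁻¹ : ℝ) : ℂ) ^ (1 / 2 : ℂ)) := by
      rw [Real.rpow_neg hξ.le, ← Real.inv_rpow hξ.le, Complex.ofReal_cpow (by positivity)]
      norm_num
    have e3 : (-(y : ℂ) ^ 2 / (4 * (z * ξ))) = ((-d / ξ : ℝ) : ℂ) + Complex.I * (c / ξ : ℝ) := by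
      have hconj : z * (ε - 3 * τ * Complex.I) = N := by
        rw [hz, hN]; push_cast; ring_nf; simp only [Complex.I_sq]; ring
      have hN' : (N : ℂ) ≠ 0 := by exact_mod_cast hN0.ne'
      rw [hd, hc]
      push_cast
      field_simp
      linear_combination (y : ℂ) ^ 2 * hconj
    rw [e1, Complex.ofReal_mul_cpow_of_pos (by positivity)
      (div_ne_zero (by exact_mod_cast Real.pi_ne_zero) hz0), e3, Complex.exp_add,
      Complex.ofReal_mul, e2, ← hA]
    have e4 : Complex.exp (Complex.I * (x * ξ + τ * ξ ^ 3 + c / ξ : ℝ))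
        = Complex.exp (Complex.I * (x * ξ + τ * ξ ^ 3 : ℝ)) * Complex.exp (Complex.I * (c / ξ : ℝ)) := by
      rw [← Complex.exp_add]; congr 1; push_cast; ring
    rw [e4, Complex.ofReal_exp]
    ring
  have nA : ‖A‖ ≤ 2 * |τ| ^ (-(1 / 2) : ℝ) := by
    rw [hA, show (1 / 2 : ℂ) = ((1 / 2 : ℝ) : ℂ) by norm_num, Complex.norm_cpow_real,
      Real.rpow_neg hτ'.le, ← Real.inv_rpow hτ'.le, ← Real.sqrt_eq_rpow, ← Real.sqrt_eq_rpow,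
      norm_div, Complex.norm_real, Real.norm_of_nonneg Real.pi_pos.le]
    have : 3 * |τ| ≤ ‖z‖ := by
      have := Complex.abs_im_le_norm z
      rwa [hzim, abs_mul, abs_of_pos (by norm_num : (0:ℝ) < 3)] at this
    have h2 : Real.pi / ‖z‖ ≤ 2 ^ 2 * |τ|⁻¹ := by
      rw [← div_eq_mul_inv, div_le_div_iff₀ (by linarith) hτ']
      nlinarith [Real.pi_lt_four]
    refine (Real.sqrt_le_sqrt h2).trans_eq ?_
    rw [Real.sqrt_mul (by norm_num), Real.sqrt_sq (by norm_num)]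
  rw [setIntegral_indicator measurableSet_Iic, Set.Ioi_inter_Iic,
    setIntegral_congr_fun measurableSet_Ioc (fun ξ hξ => inner ξ hξ.1), integral_const_mul, norm_mul,
    ← intervalIntegral.integral_of_le hR]
  have main := norm_integral_rpow_mul_cexp_le_abs (x := x) (R := R) (d := d) (c := c) hτ
    (by rw [show τ * c = 3 * τ ^ 2 * y ^ 2 / (4 * N) by rw [hc]; ring]; positivity) (by positivity) hR
  refine (mul_le_mul nA main (norm_nonneg _) (by positivity)).trans_eq ?_
  rw [show (-(2 / 3) : ℝ) = -(1 / 2) + -(1 / 6) by norm_num, Real.rpow_add hτ']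
  ring

/-- An integrable frequency cutoff, Gaussian in `η` on each line `ξ = const`, which tends to
`1` almost everywhere as `n → ∞`. -/
noncomputable def cutNV (n : ℕ) (w : ℝ × ℝ) : ℝ :=
  {w : ℝ × ℝ | |w.1| ≤ n}.indicator (fun w => Real.exp (-(|w.1| * w.2 ^ 2 / (n + 1)))) w

/-- The unimodular oscillating factor `exp (i (x · w + t φ(w)))`. -/
noncomputable def phaseNV (t : ℝ) (x w : ℝ × ℝ) : ℂ :=
  Complex.exp (Complex.I * (x.1 * w.1 + x.2 * w.2 + t * phiNV w.1 w.2 : ℝ))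

theorem norm_phaseNV (t : ℝ) (x w : ℝ × ℝ) : ‖phaseNV t x w‖ = 1 := by
  rw [phaseNV, mul_comm, Complex.norm_exp_ofReal_mul_I]

theorem continuous_phaseNV :
    Continuous fun z : ℝ × (ℝ × ℝ) × (ℝ × ℝ) => phaseNV z.1 z.2.1 z.2.2 := by
  unfold phaseNV phiNV
  fun_prop

theorem cutNV_nonneg (n : ℕ) (w : ℝ × ℝ) : 0 ≤ cutNV n w :=
  Set.indicator_nonneg (fun _ _ => Real.exp_nonneg _) w

theorem cutNV_le_one (n : ℕ) (w : ℝ × ℝ) : cutNV n w ≤ 1 := by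
  refine Set.indicator_le_self' (fun _ _ => Real.exp_nonneg _) w |>.trans ?_
  rw [Real.exp_le_one_iff]
  have : 0 ≤ |w.1| * w.2 ^ 2 / (n + 1) := by positivity
  linarith

theorem measurable_cutNV (n : ℕ) : Measurable (cutNV n) := by
  refine Measurable.indicator (by fun_prop) ?_
  exact measurableSet_le (by fun_prop) (by fun_prop)

theorem tendsto_cutNV (w : ℝ × ℝ) :
    Filter.Tendsto (fun n => cutNV n w) Filter.atTop (nhds 1) := by
  have h : Filter.Tendsto (fun n : ℕ => Real.exp (-(|w.1| * w.2 ^ 2 / (n + 1)))) Filter.atTop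
      (nhds 1) := by
    rw [show (1 : ℝ) = Real.exp (-0) by simp]
    refine (Real.continuous_exp.tendsto _).comp (Filter.Tendsto.neg ?_)
    simpa [div_eq_mul_inv] using
      (tendsto_one_div_add_atTop_nhds_zero_nat (𝕜 := ℝ)).const_mul (|w.1| * w.2 ^ 2)
  refine h.congr' ?_
  obtain ⟨m, hm⟩ := exists_nat_ge |w.1|
  filter_upwards [Filter.eventually_ge_atTop m] with n hn
  rw [cutNV, Set.indicator_of_mem]
  exact hm.trans (by exact_mod_cast hn)

theorem integrable_cutNV (n : ℕ) : Integrable (cutNV n) := by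
  have hsm := (measurable_cutNV n).aestronglyMeasurable (μ := (volume : Measure (ℝ × ℝ)))
  have fiber : ∀ ξ η : ℝ, cutNV n (ξ, η)
      = (Set.Icc (-(n : ℝ)) n).indicator (fun ξ => Real.exp (-(|ξ| / (n + 1)) * η ^ 2)) ξ := by
    intro ξ η
    simp only [cutNV, Set.indicator, Set.mem_ofPred_eq, Set.mem_Icc, abs_le]
    congr 2
    ring
  rw [Measure.volume_eq_prod] at hsm ⊢
  rw [integrable_prod_iff hsm]
  constructor
  · have : ∀ᵐ ξ : ℝ, ξ ≠ 0 := by simp [ae_iff]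
    filter_upwards [this] with ξ hξ
    simp only [fiber]
    by_cases h : ξ ∈ Set.Icc (-(n : ℝ)) n
    · simp only [Set.indicator_of_mem h]
      exact integrable_exp_neg_mul_sq (by positivity)
    · simp only [Set.indicator_of_notMem h]
      exact integrable_zero _ _ _
  · have e : ∀ ξ : ℝ, ∫ η, ‖cutNV n (ξ, η)‖
        = (Set.Icc (-(n : ℝ)) n).indicator (fun ξ => √(Real.pi * (n + 1)) * |ξ| ^ (-(1 / 2) : ℝ)) ξ := by
      intro ξ
      simp only [fiber]
      by_cases h : ξ ∈ Set.Icc (-(n : ℝ)) n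
      · simp only [Set.indicator_of_mem h, Real.norm_of_nonneg (Real.exp_nonneg _)]
        rw [integral_gaussian, Real.rpow_neg (abs_nonneg _), ← Real.sqrt_eq_rpow, ← Real.sqrt_inv,
          ← Real.sqrt_mul (by positivity)]
        congr 1
        field_simp
      · simp only [Set.indicator_of_notMem h]
        simp
    simp only [e]
    rw [integrable_indicator_iff measurableSet_Icc]
    refine Integrable.const_mul ?_ _
    change IntegrableOn _ _ _
    rw [integrableOn_Icc_iff_integrableOn_Ioc, ← intervalIntegrable_iff_integrableOn_Ioc_of_le
      (by have : (0:ℝ) ≤ n := n.cast_nonneg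
          linarith)]
    have h0 : IntervalIntegrable (fun ξ : ℝ => |ξ| ^ (-(1 / 2) : ℝ)) volume 0 n := by
      refine (intervalIntegral.intervalIntegrable_rpow' (r := -(1 / 2)) (by norm_num)).congr ?_
      rw [Set.uIoc_of_le n.cast_nonneg]
      exact fun ξ hξ => by simp only [abs_of_pos hξ.1]
    have h1 := (IntervalIntegrable.iff_comp_neg (by simp)).1 h0
    simp only [abs_neg, neg_zero] at h1
    exact h1.symm.trans h0

/-- Dispersive bound for the regularised kernel, uniform in the cutoff. -/
theorem norm_integral_phaseNV_mul_cutNV_le (n : ℕ) {τ : ℝ} (hτ : τ ≠ 0) (x : ℝ × ℝ) :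
    ‖∫ w, phaseNV τ x w * cutNV n w‖ ≤ 56 * |τ| ^ (-(2 / 3) : ℝ) := by
  have hInt : Integrable (fun w => phaseNV τ x w * cutNV n w) := by
    refine (integrable_cutNV n).ofReal.bdd_mul (c := 1)
      (f := fun w => phaseNV τ x w) ?_ ?_
    · exact (continuous_phaseNV.comp (by fun_prop : Continuous fun w : ℝ × ℝ =>
        (τ, x, w))).aestronglyMeasurable
    · exact Filter.Eventually.of_forall fun w => (norm_phaseNV _ _ _).le
  rw [Measure.volume_eq_prod] at hInt ⊢
  rw [integral_prod _ hInt]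
  have hk := hInt.integral_prod_left
  set k : ℝ → ℂ := fun ξ => ∫ η, phaseNV τ x (ξ, η) * cutNV n (ξ, η) with hkdef
  set G : ℝ → ℝ → ℝ → ℂ := fun t u ξ => (Set.Iic (n : ℝ)).indicator (fun ξ : ℝ =>
      Complex.exp (Complex.I * (u * ξ + t * ξ ^ 3 : ℝ)) *
        ∫ η : ℝ, Complex.exp (Complex.I * x.2 * η)
          * Complex.exp (-((((1 / (n + 1) : ℝ) : ℂ) + 3 * t * Complex.I) * ξ) * η ^ 2)) ξ with hG
  have e1 : ∀ ξ ∈ Set.Ioi (0 : ℝ), k ξ = G τ x.1 ξ := by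
    intro ξ hξ
    have hξ : 0 < ξ := hξ
    simp only [hkdef, hG, Set.indicator, Set.mem_Iic]
    split_ifs with h
    · rw [← integral_const_mul]
      congr 1 with η
      rw [cutNV, Set.indicator_of_mem (by simpa [abs_of_pos hξ] using h), phaseNV, phiNV,
        Complex.ofReal_exp, ← Complex.exp_add, ← Complex.exp_add, ← Complex.exp_add, abs_of_pos hξ]
      congr 1
      push_cast
      ring_nf
    · rw [← integral_zero ℝ ℂ]
      congr 1 with η
      rw [cutNV, Set.indicator_of_notMem (by simpa [abs_of_pos hξ] using h)]
      simp
  have e2 : ∀ ξ ∈ Set.Ioi (0 : ℝ), k (-ξ) = G (-τ) (-x.1) ξ := by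
    intro ξ hξ
    have hξ : 0 < ξ := hξ
    simp only [hkdef, hG, Set.indicator, Set.mem_Iic]
    split_ifs with h
    · rw [← integral_const_mul]
      congr 1 with η
      rw [cutNV, Set.indicator_of_mem (by simpa [abs_of_pos hξ] using h), phaseNV, phiNV,
        Complex.ofReal_exp, ← Complex.exp_add, ← Complex.exp_add, ← Complex.exp_add, abs_neg,
        abs_of_pos hξ]
      congr 1
      push_cast
      ring_nf
    · rw [← integral_zero ℝ ℂ]
      congr 1 with η
      rw [cutNV, Set.indicator_of_notMem (by simpa [abs_of_pos hξ] using h)]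
      simp
  rw [← setIntegral_univ, ← Set.Iic_union_Ioi (a := (0 : ℝ)), setIntegral_union
    (Set.Iic_disjoint_Ioi le_rfl) measurableSet_Ioi hk.integrableOn hk.integrableOn,
    ← neg_zero, ← integral_comp_neg_Ioi, neg_zero, setIntegral_congr_fun measurableSet_Ioi e1,
    setIntegral_congr_fun measurableSet_Ioi e2]
  have hε : (0 : ℝ) < 1 / (n + 1) := by positivity
  have b1 := norm_integral_Ioi_gaussian_fiber_le (x := x.1) (y := x.2) hε hτ
    (n.cast_nonneg : (0 : ℝ) ≤ n)
  have b2 := norm_integral_Ioi_gaussian_fiber_le (x := -x.1) (y := x.2) hε (neg_ne_zero.2 hτ)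
    (n.cast_nonneg : (0 : ℝ) ≤ n)
  rw [abs_neg] at b2
  refine (norm_add_le _ _).trans ((add_le_add b2 b1).trans_eq (by ring))

open ComplexConjugate in
theorem lintegral_mul_enorm_integral_sq_le {X W : Type*} [MeasurableSpace X] [MeasurableSpace W]
    {μ : Measure X} {ν : Measure W} [SFinite μ] [SFinite ν] {H : X → W → ℂ} {c : X → ℝ} {m : W → ℝ}
    (hH : Measurable (Function.uncurry H)) (hc : Integrable c μ) (hHc : ∀ x w, ‖H x w‖ ≤ c x)
    (hm : Integrable m ν) (hm0 : ∀ w, 0 ≤ m w) :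
    ∫⁻ w, ENNReal.ofReal (m w) * ‖∫ x, H x w ∂μ‖ₑ ^ 2 ∂ν
      ≤ ∫⁻ x, ∫⁻ y, ‖∫ w, m w * (H x w * conj (H y w)) ∂ν‖ₑ ∂μ ∂μ := by
  set h : W → ℂ := fun w => ∫ x, H x w ∂μ with hh
  have hHsm : StronglyMeasurable (Function.uncurry H) := hH.stronglyMeasurable
  have hhm : StronglyMeasurable h := hHsm.integral_prod_left
  have hhb : ∀ w, ‖h w‖ ≤ ∫ x, c x ∂μ := fun w =>
    norm_integral_le_of_norm_le hc (Filter.Eventually.of_forall fun x => hHc x w)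
  have hInt : Integrable (fun w => (m w : ℂ) * (h w * conj (h w))) ν := by
    refine hm.ofReal.mul_bdd (c := (∫ x, c x ∂μ) ^ 2) ?_ ?_
    · exact (hhm.mul (Complex.continuous_conj.comp_stronglyMeasurable hhm)).aestronglyMeasurable
    · refine Filter.Eventually.of_forall fun w => ?_
      rw [norm_mul, Complex.norm_conj, ← sq]
      gcongr
      exact hhb w
  have e0 : ∫⁻ w, ENNReal.ofReal (m w) * ‖h w‖ₑ ^ 2 ∂ν
      = ‖∫ w, (m w : ℂ) * (h w * conj (h w)) ∂ν‖ₑ := by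
    have er : ∀ w, (m w : ℂ) * (h w * conj (h w)) = ((m w * ‖h w‖ ^ 2 : ℝ) : ℂ) := by
      intro w
      rw [Complex.mul_conj, Complex.normSq_eq_norm_sq]
      push_cast; rfl
    simp only [er] at hInt ⊢
    have hInt' : Integrable (fun w => m w * ‖h w‖ ^ 2) ν := by
      exact hInt.re.congr (Filter.Eventually.of_forall fun w => Complex.ofReal_re _)
    have nn : ∀ w, 0 ≤ m w * ‖h w‖ ^ 2 := fun w => mul_nonneg (hm0 w) (by positivity)
    rw [integral_complex_ofReal, ← ofReal_norm, Complex.norm_real,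
      Real.norm_of_nonneg (integral_nonneg nn),
      ofReal_integral_eq_lintegral_ofReal hInt' (Filter.Eventually.of_forall nn)]
    congr 1 with w
    rw [ENNReal.ofReal_mul (hm0 w), ENNReal.ofReal_pow (norm_nonneg _), ofReal_norm]
  rw [e0]
  have e1 : ∀ w, (m w : ℂ) * (h w * conj (h w))
      = ∫ z, (m w : ℂ) * (H z.1 w * conj (H z.2 w)) ∂(μ.prod μ) := by
    intro w
    rw [integral_const_mul, integral_prod_mul (fun x => H x w) (fun y => conj (H y w)),
      integral_conj]
  simp only [e1]
  have hm3 : Measurable fun p : W × (X × X) => H p.2.1 p.1 * conj (H p.2.2 p.1) := by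
    refine (hH.comp (by fun_prop : Measurable fun p : W × (X × X) => (p.2.1, p.1))).mul ?_
    exact Complex.continuous_conj.measurable.comp
      (hH.comp (by fun_prop : Measurable fun p : W × (X × X) => (p.2.2, p.1)))
  rw [integral_integral_swap]
  · refine (enorm_integral_le_lintegral_enorm _).trans ?_
    exact lintegral_prod_le _
  · refine (hm.norm.mul_prod (hc.mul_prod hc)).mono' ?_ ?_
    · exact (hm.ofReal.aestronglyMeasurable.comp_fst).mul hm3.aestronglyMeasurable
    · refine Filter.Eventually.of_forall fun p => ?_
      simp only [Function.uncurry]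
      rw [norm_mul, norm_mul, Complex.norm_conj, Complex.norm_real]
      have := hHc p.2.1 p.1
      have h2 := hHc p.2.2 p.1
      have h3 := (norm_nonneg _).trans this
      gcongr

theorem lintegral_le_of_tendsto_one {W : Type*} [MeasurableSpace W] {ν : Measure W}
    {m : ℕ → W → ℝ} (hm : ∀ n, Measurable (m n))
    (hlim : ∀ w, Filter.Tendsto (fun n => m n w) Filter.atTop (nhds 1))
    {f : W → ENNReal} (hf : Measurable f) {C : ENNReal}
    (h : ∀ n, ∫⁻ w, ENNReal.ofReal (m n w) * f w ∂ν ≤ C) : ∫⁻ w, f w ∂ν ≤ C := by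
  have : ∀ w, f w = Filter.liminf (fun n => ENNReal.ofReal (m n w) * f w) Filter.atTop := by
    intro w
    have h1 := ENNReal.tendsto_ofReal (hlim w)
    have := ENNReal.Tendsto.mul_const (b := f w) h1 (Or.inl (by simp))
    rw [ENNReal.ofReal_one, one_mul] at this
    exact this.liminf_eq.symm
  calc ∫⁻ w, f w ∂ν = ∫⁻ w, Filter.liminf (fun n => ENNReal.ofReal (m n w) * f w) Filter.atTop ∂ν :=
        lintegral_congr this
    _ ≤ Filter.liminf (fun n => ∫⁻ w, ENNReal.ofReal (m n w) * f w ∂ν) Filter.atTop :=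
        lintegral_liminf_le fun n => (hm n).ennreal_ofReal.mul hf
    _ ≤ C := (Filter.liminf_le_liminf (Filter.Eventually.of_forall h)).trans (by simp)

theorem FT2_eq_integral_phaseNV (f : ℝ × ℝ → ℂ) (w : ℝ × ℝ) :
    FT2 f w = ∫ v, phaseNV 0 (-v) w * f v := by
  rw [FT2]
  congr 1 with v
  rw [phaseNV]
  congr 2
  simp
  ring

theorem phaseNV_mul (s t : ℝ) (x y w : ℝ × ℝ) :
    phaseNV s x w * phaseNV t y w = phaseNV (s + t) (x + y) w := by
  simp only [phaseNV]
  rw [← Complex.exp_add]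
  congr 1
  simp
  ring

theorem conj_phaseNV (t : ℝ) (x w : ℝ × ℝ) :
    (starRingEnd ℂ) (phaseNV t x w) = phaseNV (-t) (-x) w := by
  simp only [phaseNV]
  rw [← Complex.exp_conj, map_mul, Complex.conj_I, Complex.conj_ofReal]
  congr 1
  simp
  ring

theorem measurable_FT2 {f : ℝ × ℝ → ℂ} (hf : Measurable f) : Measurable (FT2 f) := by
  have : Measurable (Function.uncurry fun w v : ℝ × ℝ => phaseNV 0 (-v) w * f v) := by
    refine Measurable.mul ?_ (hf.comp measurable_snd)
    exact (continuous_phaseNV.comp (by fun_prop : Continuous fun p : (ℝ × ℝ) × (ℝ × ℝ) =>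
        ((0 : ℝ), -p.2, p.1))).measurable
  convert (this.stronglyMeasurable.integral_prod_right (ν := volume)).measurable using 1
  ext w
  exact FT2_eq_integral_phaseNV f w

theorem norm_FT2_le (f : ℝ × ℝ → ℂ) (w : ℝ × ℝ) : ‖FT2 f w‖ ≤ ∫ v, ‖f v‖ := by
  rw [FT2_eq_integral_phaseNV]
  refine (norm_integral_le_integral_norm _).trans_eq ?_
  simp only [norm_mul, norm_phaseNV, one_mul]

theorem integral_phaseNV_mul_gaussian {δ : ℝ} (hδ : 0 < δ) (x : ℝ × ℝ) :
    ∫ w : ℝ × ℝ, ((Real.exp (-δ * w.1 ^ 2) * Real.exp (-δ * w.2 ^ 2) : ℝ) : ℂ) * phaseNV 0 x w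
      = ((√(Real.pi / δ) * Real.exp (-(1 / (4 * δ)) * x.1 ^ 2)
        * (√(Real.pi / δ) * Real.exp (-(1 / (4 * δ)) * x.2 ^ 2)) : ℝ) : ℂ) := by
  have one : ∀ t : ℝ, ∫ u : ℝ, Complex.exp (Complex.I * t * u) * Complex.exp (-(δ : ℂ) * u ^ 2)
      = ((√(Real.pi / δ) * Real.exp (-(1 / (4 * δ)) * t ^ 2) : ℝ) : ℂ) := by
    intro t
    rw [fourierIntegral_gaussian (by simpa using hδ), Real.sqrt_eq_rpow, Complex.ofReal_mul,
      Complex.ofReal_cpow (by positivity)]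
    push_cast
    congr 2
    field_simp
  rw [Complex.ofReal_mul, ← one, ← one, ← integral_prod_mul, Measure.volume_eq_prod]
  congr 1 with w
  simp only [phaseNV]
  push_cast
  simp only [← Complex.exp_add]
  congr 1
  ring

/-- Bessel inequality for the Fourier transform on `ℝ²`. -/
theorem lintegral_enorm_FT2_sq_le {g : ℝ × ℝ → ℂ} (hg : Measurable g) (hgi : Integrable g) :
    ∫⁻ w, ‖FT2 g w‖ₑ ^ 2 ≤ ENNReal.ofReal ((2 * Real.pi) ^ 2) * ∫⁻ v, ‖g v‖ₑ ^ 2 := by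
  refine lintegral_le_of_tendsto_one
    (m := fun n w => Real.exp (-(1 / (n + 1)) * w.1 ^ 2) * Real.exp (-(1 / (n + 1)) * w.2 ^ 2))
    (fun n => by fun_prop) (fun w => ?_) ((measurable_FT2 hg).enorm.pow_const 2) (fun n => ?_)
  · have h0 := tendsto_one_div_add_atTop_nhds_zero_nat (𝕜 := ℝ)
    have h1 : ∀ u : ℝ, Filter.Tendsto (fun n : ℕ => Real.exp (-(1 / (n + 1)) * u)) Filter.atTop
        (nhds 1) := by
      intro u
      have := (Real.continuous_exp.tendsto _).comp (h0.neg.mul_const u)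
      simp only [neg_zero, zero_mul, Real.exp_zero] at this
      exact this
    have := (h1 (w.1 ^ 2)).mul (h1 (w.2 ^ 2))
    rwa [one_mul] at this
  set δ : ℝ := 1 / (n + 1) with hδdef
  have hδ : 0 < δ := by positivity
  simp only [FT2_eq_integral_phaseNV]
  have gi : Integrable fun w : ℝ × ℝ => Real.exp (-δ * w.1 ^ 2) * Real.exp (-δ * w.2 ^ 2) :=
    (integrable_exp_neg_mul_sq hδ).mul_prod (integrable_exp_neg_mul_sq hδ)
  refine (lintegral_mul_enorm_integral_sq_le (c := fun v => ‖g v‖) ?_ hgi.norm ?_ gi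
    (fun w => by positivity)).trans ?_
  · refine Measurable.mul ?_ (hg.comp measurable_fst)
    exact (continuous_phaseNV.comp (by fun_prop : Continuous fun p : (ℝ × ℝ) × (ℝ × ℝ) =>
        ((0 : ℝ), -p.1, p.2))).measurable
  · intro v w
    rw [norm_mul, norm_phaseNV, one_mul]
  set G : ℝ × ℝ → ℝ := fun x => √(Real.pi / δ) * Real.exp (-(1 / (4 * δ)) * x.1 ^ 2)
        * (√(Real.pi / δ) * Real.exp (-(1 / (4 * δ)) * x.2 ^ 2)) with hG
  have G0 : ∀ x, 0 ≤ G x := fun x => by simp only [hG]; positivity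
  have G1 : Integrable (fun u : ℝ => √(Real.pi / δ) * Real.exp (-(1 / (4 * δ)) * u ^ 2)) :=
    (integrable_exp_neg_mul_sq (by positivity)).const_mul _
  have GI : ∫⁻ x, ENNReal.ofReal (G x) = ENNReal.ofReal ((2 * Real.pi) ^ 2) := by
    have Gi : Integrable G := G1.mul_prod G1
    rw [← ofReal_integral_eq_lintegral_ofReal Gi (Filter.Eventually.of_forall G0)]
    congr 1
    rw [Measure.volume_eq_prod, integral_prod_mul
      (fun u : ℝ => √(Real.pi / δ) * Real.exp (-(1 / (4 * δ)) * u ^ 2))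
      (fun u : ℝ => √(Real.pi / δ) * Real.exp (-(1 / (4 * δ)) * u ^ 2)), integral_const_mul,
      integral_gaussian, ← Real.sqrt_mul (by positivity), sq]
    have : Real.pi / δ * (Real.pi / (1 / (4 * δ))) = (2 * Real.pi) ^ 2 := by field_simp; ring
    rw [this, Real.sqrt_sq (by positivity)]
  have Gm : Measurable G := by simp only [hG]; fun_prop
  have Gt : ∀ x, ∫⁻ y, ENNReal.ofReal (G (y - x)) = ENNReal.ofReal ((2 * Real.pi) ^ 2) := by
    intro x
    rw [← GI]
    exact lintegral_sub_right_eq_self (fun y => ENNReal.ofReal (G y)) x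
  have Gs : ∀ x, G (-x) = G x := fun x => by simp [hG]
  have e : ∀ x y, ‖∫ w : ℝ × ℝ, ((Real.exp (-δ * w.1 ^ 2) * Real.exp (-δ * w.2 ^ 2) : ℝ) : ℂ)
      * (phaseNV 0 (-x) w * g x * (starRingEnd ℂ) (phaseNV 0 (-y) w * g y))‖ₑ
      = ‖g x‖ₑ * ‖g y‖ₑ * ENNReal.ofReal (G (y - x)) := by
    intro x y
    have : ∀ w : ℝ × ℝ, ((Real.exp (-δ * w.1 ^ 2) * Real.exp (-δ * w.2 ^ 2) : ℝ) : ℂ)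
      * (phaseNV 0 (-x) w * g x * (starRingEnd ℂ) (phaseNV 0 (-y) w * g y))
      = (g x * (starRingEnd ℂ) (g y)) *
        (((Real.exp (-δ * w.1 ^ 2) * Real.exp (-δ * w.2 ^ 2) : ℝ) : ℂ) * phaseNV 0 (y - x) w) := by
      intro w
      rw [map_mul, conj_phaseNV, show y - x = -x + - -y by rw [neg_neg]; abel]
      conv_rhs => rw [show (0 : ℝ) = 0 + -0 by simp, ← phaseNV_mul]
      ring
    simp only [this]
    rw [integral_const_mul, integral_phaseNV_mul_gaussian hδ, enorm_mul, enorm_mul,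
      ← ofReal_norm ((G (y - x) : ℝ) : ℂ), Complex.norm_real, Real.norm_of_nonneg (G0 _)]
    congr 2
    exact (RCLike.enorm_conj _)
  simp only [e]
  have am : ∀ a b : ENNReal, a * b ≤ 2⁻¹ * a ^ 2 + 2⁻¹ * b ^ 2 := by
    intro a b
    rcases eq_or_ne a ⊤ with rfl | ha
    · simp [ENNReal.mul_top]
    rcases eq_or_ne b ⊤ with rfl | hb
    · simp [ENNReal.mul_top]
    lift a to NNReal using ha
    lift b to NNReal using hb
    have h2 : (2⁻¹ : ENNReal) = ((2⁻¹ : NNReal) : ENNReal) := by simp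
    rw [h2]
    norm_cast
    rw [← NNReal.coe_le_coe]
    push_cast
    nlinarith [sq_nonneg ((a : ℝ) - b)]
  have S : ∫⁻ x, ∫⁻ y, ‖g x‖ₑ ^ 2 * ENNReal.ofReal (G (y - x))
      = ENNReal.ofReal ((2 * Real.pi) ^ 2) * ∫⁻ v, ‖g v‖ₑ ^ 2 := by
    have : ∀ x, ∫⁻ y, ‖g x‖ₑ ^ 2 * ENNReal.ofReal (G (y - x))
        = ‖g x‖ₑ ^ 2 * ENNReal.ofReal ((2 * Real.pi) ^ 2) := by
      intro x
      rw [lintegral_const_mul' _ _ (by simp), Gt]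
    simp only [this]
    rw [lintegral_mul_const' _ _ (by simp), mul_comm]
  have S' : ∫⁻ x, ∫⁻ y, ‖g y‖ₑ ^ 2 * ENNReal.ofReal (G (y - x))
      = ENNReal.ofReal ((2 * Real.pi) ^ 2) * ∫⁻ v, ‖g v‖ₑ ^ 2 := by
    rw [lintegral_lintegral_swap, ← S]
    · congr 1 with x
      congr 1 with y
      rw [← Gs, neg_sub]
    · refine Measurable.aemeasurable ?_
      simp only [Function.uncurry_def]
      fun_prop
  calc ∫⁻ x, ∫⁻ y, ‖g x‖ₑ * ‖g y‖ₑ * ENNReal.ofReal (G (y - x))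
      ≤ ∫⁻ x, ∫⁻ y, (2⁻¹ * (‖g x‖ₑ ^ 2 * ENNReal.ofReal (G (y - x)))
          + 2⁻¹ * (‖g y‖ₑ ^ 2 * ENNReal.ofReal (G (y - x)))) := by
        gcongr with x y
        refine (mul_le_mul_left (am _ _) _).trans_eq ?_
        ring
    _ = 2⁻¹ * (∫⁻ x, ∫⁻ y, ‖g x‖ₑ ^ 2 * ENNReal.ofReal (G (y - x)))
          + 2⁻¹ * ∫⁻ x, ∫⁻ y, ‖g y‖ₑ ^ 2 * ENNReal.ofReal (G (y - x)) := by
        rw [← lintegral_const_mul' _ _ (by simp), ← lintegral_const_mul' _ _ (by simp),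
          ← lintegral_add_left]
        · congr 1 with x
          rw [← lintegral_const_mul' _ _ (by simp), ← lintegral_const_mul' _ _ (by simp),
            ← lintegral_add_left]
          fun_prop
        · refine Measurable.const_mul (Measurable.lintegral_prod_right' (f := fun p : (ℝ × ℝ) × (ℝ × ℝ) =>
            ‖g p.1‖ₑ ^ 2 * ENNReal.ofReal (G (p.2 - p.1))) ?_) _
          fun_prop
    _ = _ := by
        rw [S, S', ← add_mul, ENNReal.inv_two_add_inv_two, one_mul]

/-- Real interpolation between `L¹ → L^∞` and `L² → L²`. -/
theorem lintegral_norm_rpow_le_of_L1_L2 {α β : Type*} [MeasurableSpace α] [MeasurableSpace β]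
    {μ : Measure α} {ν : Measure β} [SFinite μ] {T : (α → ℂ) → β → ℂ} {A q : ℝ}
    {B : ENNReal} (hq : 2 < q) (hA : 0 < A)
    (hTm : ∀ g, Measurable g → Integrable g μ → Measurable (T g))
    (hadd : ∀ g₁ g₂, Measurable g₁ → Integrable g₁ μ → Measurable g₂ → Integrable g₂ μ →
      ∀ y, T (g₁ + g₂) y = T g₁ y + T g₂ y)
    (h1 : ∀ g, Measurable g → Integrable g μ → ∀ y, ‖T g y‖ ≤ A * ∫ x, ‖g x‖ ∂μ)
    (h2 : ∀ g, Measurable g → Integrable g μ → ∫⁻ y, ‖T g y‖ₑ ^ 2 ∂ν ≤ B * ∫⁻ x, ‖g x‖ₑ ^ 2 ∂μ)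
    {f : α → ℂ} (hf : Measurable f) (hfi : Integrable f μ)
    (hfr : Integrable (fun x => ‖f x‖ ^ (q / (q - 1))) μ) :
    ∫⁻ y, ENNReal.ofReal (‖T f y‖ ^ q) ∂ν
      ≤ ENNReal.ofReal (4 * q / (q - 2) * (2 * A) ^ (q - 2)
        * (∫ x, ‖f x‖ ^ (q / (q - 1)) ∂μ) ^ (q - 1)) * B := by
  have hq0 : 0 < q := by linarith
  have hq1 : 0 < q - 1 := by linarith
  have hq2 : 0 < q - 2 := by linarith
  set r := q / (q - 1) with hr
  have hr0 : 0 < r := by positivity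
  have hr1 : r - 1 = 1 / (q - 1) := by rw [hr]; field_simp; ring
  have hr1' : 0 < r - 1 := by rw [hr1]; positivity
  set N := ∫ x, ‖f x‖ ^ r ∂μ with hN
  have nn : ∀ x, 0 ≤ ‖f x‖ ^ r := fun x => by positivity
  have hN0 : 0 ≤ N := integral_nonneg nn
  have hfn : Measurable fun x => ‖f x‖ := hf.norm
  rcases hN0.eq_or_lt with hN0 | hN0
  · have hz := (integral_eq_zero_iff_of_nonneg nn hfr).1 hN0.symm
    have : ∀ y, T f y = 0 := by
      intro y
      have h := h1 f hf hfi y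
      rw [integral_congr_ae (g := fun _ => (0 : ℝ)) (hz.mono fun x hx => by
        simpa [Real.rpow_eq_zero_iff_of_nonneg, hr0.ne'] using hx)] at h
      simpa using h
    simp [this, Real.zero_rpow hq0.ne']
  set P := 2 * A * N with hP
  have hP0 : 0 < P := by positivity
  set E : ℝ → Set α := fun s => {x | ‖f x‖ ^ (r - 1) * s ≤ P} with hE
  have hEm : ∀ s, MeasurableSet (E s) := fun s => measurableSet_le (by fun_prop) measurable_const
  have weak : ∀ s, 0 < s → ν {y | s < ‖T f y‖}
      ≤ ENNReal.ofReal (4 / s ^ 2) * (B * ∫⁻ x, (E s).indicator (fun x => ‖f x‖ₑ ^ 2) x ∂μ) := by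
    intro s hs
    set g := (E s).indicator f with hg
    set b := (E s)ᶜ.indicator f with hb
    have gm : Measurable g := hf.indicator (hEm s)
    have bm : Measurable b := hf.indicator (hEm s).compl
    have gi : Integrable g μ := hfi.indicator (hEm s)
    have bi : Integrable b μ := hfi.indicator (hEm s).compl
    have fgb : f = g + b := (Set.indicator_self_add_compl _ _).symm
    have bs : ∀ y, ‖T b y‖ ≤ s / 2 := by
      intro y
      refine (h1 b bm bi y).trans ?_
      have : ∫ x, ‖b x‖ ∂μ ≤ ∫ x, s / P * ‖f x‖ ^ r ∂μ := by
        refine integral_mono bi.norm (hfr.const_mul _) fun x => ?_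
        simp only [hb, Set.indicator]
        split_ifs with hx
        · have hx : P < ‖f x‖ ^ (r - 1) * s := by simpa [hE] using hx
          have e : ‖f x‖ ^ r = ‖f x‖ ^ (r - 1) * ‖f x‖ := by
            rcases (norm_nonneg (f x)).eq_or_lt with h0 | h0
            · rw [← h0]; simp [Real.zero_rpow hr0.ne']
            · conv_rhs => rw [← Real.rpow_one ‖f x‖, ← Real.rpow_mul h0.le, one_mul,
                ← Real.rpow_add h0]
              norm_num
          rw [e, div_mul_eq_mul_div, le_div_iff₀ hP0]
          nlinarith [norm_nonneg (f x)]
        · rw [norm_zero]; positivity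
      rw [integral_const_mul, ← hN] at this
      refine (mul_le_mul_of_nonneg_left this hA.le).trans_eq ?_
      rw [hP]
      field_simp
    have sub : {y | s < ‖T f y‖} ⊆ {y | ENNReal.ofReal ((s / 2) ^ 2) ≤ ‖T g y‖ₑ ^ 2} := by
      intro y hy
      have hy : s < ‖T f y‖ := hy
      have e := hadd g b gm gi bm bi y
      rw [← fgb] at e
      have := norm_add_le (T g y) (T b y)
      rw [← e] at this
      have h3 := bs y
      change ENNReal.ofReal ((s / 2) ^ 2) ≤ ‖T g y‖ₑ ^ 2
      rw [← ofReal_norm, ← ENNReal.ofReal_pow (norm_nonneg _)]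
      apply ENNReal.ofReal_le_ofReal
      gcongr
      linarith
    refine (measure_mono sub).trans ?_
    have c1 := mul_meas_ge_le_lintegral (μ := ν) ((hTm g gm gi).enorm.pow_const 2)
      (ENNReal.ofReal ((s / 2) ^ 2))
    have c2 := c1.trans (h2 g gm gi)
    have e2 : ∫⁻ x, ‖g x‖ₑ ^ 2 ∂μ = ∫⁻ x, (E s).indicator (fun x => ‖f x‖ₑ ^ 2) x ∂μ := by
      congr 1 with x
      simp only [hg, Set.indicator]
      split_ifs <;> simp
    rw [e2] at c2
    refine le_trans ?_ (mul_le_mul_right c2 _)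
    rw [← mul_assoc, ← ENNReal.ofReal_mul (by positivity)]
    rw [show 4 / s ^ 2 * (s / 2) ^ 2 = 1 by field_simp; norm_num]
    simp
  rw [lintegral_rpow_eq_lintegral_meas_lt_mul ν (Filter.Eventually.of_forall fun y => norm_nonneg _)
    (hTm f hf hfi).norm.aemeasurable hq0]
  have step : ∫⁻ s in Set.Ioi (0 : ℝ), ν {y | s < ‖T f y‖} * ENNReal.ofReal (s ^ (q - 1))
      ≤ B * ∫⁻ s in Set.Ioi (0 : ℝ), ∫⁻ x, ENNReal.ofReal (4 * s ^ (q - 3))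
        * (E s).indicator (fun x => ‖f x‖ₑ ^ 2) x ∂μ := by
    have hmeas : Measurable fun s : ℝ => ∫⁻ x, ENNReal.ofReal (4 * s ^ (q - 3))
        * (E s).indicator (fun x => ‖f x‖ₑ ^ 2) x ∂μ := by
      refine Measurable.lintegral_prod_right' (f := fun p : ℝ × α => ENNReal.ofReal (4 * p.1 ^ (q - 3))
        * (E p.1).indicator (fun x => ‖f x‖ₑ ^ 2) p.2) ?_
      refine Measurable.mul (by fun_prop) ?_
      exact Measurable.indicator (f := fun p : ℝ × α => ‖f p.2‖ₑ ^ 2)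
        (s := {p : ℝ × α | ‖f p.2‖ ^ (r - 1) * p.1 ≤ P}) (by fun_prop)
        (measurableSet_le (by fun_prop) measurable_const)
    rw [← lintegral_const_mul _ hmeas]
    refine setLIntegral_mono' measurableSet_Ioi fun s hs => ?_
    have hs : 0 < s := hs
    rw [lintegral_const_mul _ (by
      exact Measurable.indicator (by fun_prop) (hEm s))]
    refine (mul_le_mul_left (weak s hs) _).trans_eq ?_
    have e : 4 * s ^ (q - 3) = 4 / s ^ 2 * s ^ (q - 1) := by
      rw [show q - 1 = (q - 3) + (2 : ℕ) by push_cast; ring, Real.rpow_add hs, Real.rpow_natCast]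
      field_simp
    rw [e, ENNReal.ofReal_mul (by positivity)]
    ring
  have swap : ∫⁻ s in Set.Ioi (0 : ℝ), ∫⁻ x, ENNReal.ofReal (4 * s ^ (q - 3))
        * (E s).indicator (fun x => ‖f x‖ₑ ^ 2) x ∂μ
      ≤ ENNReal.ofReal (4 / (q - 2) * P ^ (q - 2) * N) := by
    rw [lintegral_lintegral_swap]
    · have inner : ∀ x, ∫⁻ s in Set.Ioi (0 : ℝ), ENNReal.ofReal (4 * s ^ (q - 3))
          * (E s).indicator (fun x => ‖f x‖ₑ ^ 2) x
          ≤ ENNReal.ofReal (4 / (q - 2) * P ^ (q - 2) * ‖f x‖ ^ r) := by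
        intro x
        rcases (norm_nonneg (f x)).eq_or_lt with h0 | h0
        · have : f x = 0 := norm_eq_zero.1 h0.symm
          simp [Set.indicator, this]
        set a := ‖f x‖ with ha
        set S := P / a ^ (r - 1) with hS
        have hS0 : 0 < S := by positivity
        have e1 : ∀ s, ENNReal.ofReal (4 * s ^ (q - 3)) * (E s).indicator (fun x => ‖f x‖ₑ ^ 2) x
            = (Set.Iic S).indicator (fun s => ENNReal.ofReal (4 * s ^ (q - 3) * a ^ 2)) s := by
          intro s
          have : x ∈ E s ↔ s ∈ Set.Iic S := by
            simp only [hE, Set.mem_ofPred_eq, Set.mem_Iic, hS]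
            rw [le_div_iff₀ (by positivity), mul_comm]
          simp only [Set.indicator, this]
          split_ifs
          · rw [ENNReal.ofReal_mul' (p := 4 * s ^ (q - 3)) (q := a ^ 2) (by positivity),
              ENNReal.ofReal_pow h0.le, ha, ofReal_norm]
          · simp
        simp only [e1]
        rw [setLIntegral_indicator measurableSet_Iic, Set.inter_comm, Set.Ioi_inter_Iic,
          ← ofReal_integral_eq_lintegral_ofReal]
        · apply ENNReal.ofReal_le_ofReal
          rw [← intervalIntegral.integral_of_le hS0.le, intervalIntegral.integral_mul_const,
            intervalIntegral.integral_const_mul, integral_rpow (Or.inl (by linarith)),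
            Real.zero_rpow (by linarith), show q - 3 + 1 = q - 2 by ring, sub_zero, hS,
            Real.div_rpow hP0.le (by positivity), ← Real.rpow_mul h0.le]
          apply le_of_eq
          have e2 : a ^ r * a ^ ((r - 1) * (q - 2)) = a ^ 2 := by
            rw [← Real.rpow_add h0, ← Real.rpow_natCast]
            congr 1
            rw [hr]
            push_cast
            field_simp
            ring
          rw [← e2]
          field_simp
        · change IntegrableOn _ _ _
          rw [← intervalIntegrable_iff_integrableOn_Ioc_of_le hS0.le]
          exact ((intervalIntegral.intervalIntegrable_rpow' (by linarith)).const_mul _).mul_const _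
        · refine (ae_restrict_mem measurableSet_Ioc).mono fun s hs => ?_
          have := hs.1
          simp only [Pi.zero_apply]
          positivity
      refine (lintegral_mono inner).trans_eq ?_
      rw [← ofReal_integral_eq_lintegral_ofReal (hfr.const_mul _)
        (Filter.Eventually.of_forall fun x => by simp only [Pi.zero_apply]; positivity), integral_const_mul]
    · refine Measurable.aemeasurable ?_
      simp only [Function.uncurry_def]
      refine Measurable.mul (by fun_prop) ?_
      exact Measurable.indicator (f := fun p : ℝ × α => ‖f p.2‖ₑ ^ 2)
        (s := {p : ℝ × α | ‖f p.2‖ ^ (r - 1) * p.1 ≤ P}) (by fun_prop)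
        (measurableSet_le (by fun_prop) measurable_const)
  refine (mul_le_mul_right (step.trans (mul_le_mul_right swap _)) _).trans_eq ?_
  rw [mul_left_comm, ← ENNReal.ofReal_mul hq0.le, mul_comm B]
  congr 2
  rw [hP, Real.mul_rpow (by positivity) hN0.le, show q - 1 = q - 2 + 1 by ring, Real.rpow_add hN0,
    Real.rpow_one]
  ring

/-- The regularised propagator `U_φ(-τ)`, up to the factor `(2π)²`. -/
noncomputable def propNV (n : ℕ) (τ : ℝ) (g : ℝ × ℝ → ℂ) (y : ℝ × ℝ) : ℂ :=
  ∫ w, phaseNV τ y w * cutNV n w * FT2 g w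

theorem phaseNV_zero_neg_neg_swap (x w : ℝ × ℝ) : phaseNV 0 (-w) (-x) = phaseNV 0 x w := by
  simp only [phaseNV]
  congr 2
  simp
  ring

theorem measurable_phaseNV (t : ℝ) (x : ℝ × ℝ) : Measurable (phaseNV t x) :=
  (continuous_phaseNV.comp (by fun_prop : Continuous fun w : ℝ × ℝ => (t, x, w))).measurable

theorem integrable_propNV_integrand (n : ℕ) (τ : ℝ) {g : ℝ × ℝ → ℂ} (hg : Measurable g)
    (y : ℝ × ℝ) : Integrable fun w => phaseNV τ y w * cutNV n w * FT2 g w := by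
  have h1 : Integrable fun w => phaseNV τ y w * (cutNV n w : ℂ) :=
    (integrable_cutNV n).ofReal.bdd_mul (c := 1) (measurable_phaseNV τ y).aestronglyMeasurable
      (Filter.Eventually.of_forall fun w => (norm_phaseNV _ _ _).le)
  exact h1.mul_bdd (measurable_FT2 hg).aestronglyMeasurable
    (Filter.Eventually.of_forall (norm_FT2_le g))

theorem FT2_add {f g : ℝ × ℝ → ℂ} (hf : Integrable f) (hg : Integrable g) (w : ℝ × ℝ) :
    FT2 (f + g) w = FT2 f w + FT2 g w := by
  have key : ∀ {h : ℝ × ℝ → ℂ}, Integrable h → Integrable fun v => phaseNV 0 (-v) w * h v := by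
    intro h hh
    refine hh.bdd_mul (c := 1) ?_ (Filter.Eventually.of_forall fun v => (norm_phaseNV _ _ _).le)
    exact (continuous_phaseNV.comp (by fun_prop : Continuous fun v : ℝ × ℝ => ((0 : ℝ), -v, w)))
      |>.aestronglyMeasurable
  simp only [FT2_eq_integral_phaseNV, Pi.add_apply, mul_add]
  exact integral_add (key hf) (key hg)

theorem propNV_add (n : ℕ) (τ : ℝ) {f g : ℝ × ℝ → ℂ} (hf : Measurable f) (hfi : Integrable f)
    (hg : Measurable g) (hgi : Integrable g) (y : ℝ × ℝ) :
    propNV n τ (f + g) y = propNV n τ f y + propNV n τ g y := by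
  simp only [propNV, FT2_add hfi hgi, mul_add]
  exact integral_add (integrable_propNV_integrand n τ hf y) (integrable_propNV_integrand n τ hg y)

theorem measurable_propNV (n : ℕ) (τ : ℝ) {g : ℝ × ℝ → ℂ} (hg : Measurable g) :
    Measurable (propNV n τ g) := by
  have : Measurable (Function.uncurry fun y w => phaseNV τ y w * cutNV n w * FT2 g w) := by
    refine Measurable.mul (Measurable.mul ?_ ?_) ((measurable_FT2 hg).comp measurable_snd)
    · exact (continuous_phaseNV.comp (by fun_prop : Continuous fun p : (ℝ × ℝ) × (ℝ × ℝ) =>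
        (τ, p.1, p.2))).measurable
    · exact Complex.measurable_ofReal.comp ((measurable_cutNV n).comp measurable_snd)
  exact (this.stronglyMeasurable.integral_prod_right (ν := volume)).measurable

theorem propNV_eq_integral_kernel (n : ℕ) (τ : ℝ) {g : ℝ × ℝ → ℂ} (hg : Measurable g)
    (hgi : Integrable g) (y : ℝ × ℝ) :
    propNV n τ g y = ∫ v, (∫ w, phaseNV τ (y - v) w * cutNV n w) * g v := by
  have e : ∀ w, phaseNV τ y w * cutNV n w * FT2 g w
      = ∫ v, phaseNV τ (y - v) w * cutNV n w * g v := by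
    intro w
    rw [FT2_eq_integral_phaseNV, ← integral_const_mul]
    congr 1 with v
    rw [sub_eq_add_neg, ← add_zero τ, ← phaseNV_mul, add_zero]
    ring
  simp only [propNV, e]
  rw [integral_integral_swap]
  · simp only [integral_mul_const]
  · refine ((integrable_cutNV n).mul_prod hgi.norm).mono' ?_ ?_
    · refine (Measurable.mul (Measurable.mul ?_ ?_) (hg.comp measurable_snd)).aestronglyMeasurable
      · exact (continuous_phaseNV.comp (by fun_prop : Continuous fun p : (ℝ × ℝ) × (ℝ × ℝ) =>
          (τ, y - p.2, p.1))).measurable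
      · exact Complex.measurable_ofReal.comp ((measurable_cutNV n).comp measurable_fst)
    · refine Filter.Eventually.of_forall fun p => ?_
      simp only [Function.uncurry, norm_mul, norm_phaseNV, one_mul, Complex.norm_real,
        Real.norm_of_nonneg (cutNV_nonneg _ _), le_refl]

theorem norm_propNV_le (n : ℕ) {τ : ℝ} (hτ : τ ≠ 0) {g : ℝ × ℝ → ℂ} (hg : Measurable g)
    (hgi : Integrable g) (y : ℝ × ℝ) :
    ‖propNV n τ g y‖ ≤ 56 * |τ| ^ (-(2 / 3) : ℝ) * ∫ v, ‖g v‖ := by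
  rw [propNV_eq_integral_kernel n τ hg hgi, ← integral_const_mul]
  refine norm_integral_le_of_norm_le (hgi.norm.const_mul _) (Filter.Eventually.of_forall fun v => ?_)
  rw [norm_mul]
  gcongr
  exact norm_integral_phaseNV_mul_cutNV_le n hτ _

theorem lintegral_enorm_propNV_sq_le (n : ℕ) (τ : ℝ) {g : ℝ × ℝ → ℂ} (hg : Measurable g)
    (hgi : Integrable g) :
    ∫⁻ y, ‖propNV n τ g y‖ₑ ^ 2 ≤ ENNReal.ofReal ((2 * Real.pi) ^ 4) * ∫⁻ v, ‖g v‖ₑ ^ 2 := by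
  set h : ℝ × ℝ → ℂ := fun w => phaseNV τ 0 w * cutNV n w * FT2 g w with hh
  have e : ∀ y, propNV n τ g y = FT2 h (-y) := by
    intro y
    rw [FT2_eq_integral_phaseNV, propNV]
    congr 1 with w
    rw [hh, ← mul_assoc, ← mul_assoc, phaseNV_zero_neg_neg_swap, phaseNV_mul]
    simp
  have hm : Measurable h := ((measurable_phaseNV τ 0).mul
    (Complex.measurable_ofReal.comp (measurable_cutNV n))).mul (measurable_FT2 hg)
  have hle : ∫⁻ w, ‖h w‖ₑ ^ 2 ≤ ∫⁻ w, ‖FT2 g w‖ₑ ^ 2 := by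
    gcongr with w
    rw [← ofReal_norm, ← ofReal_norm]
    apply ENNReal.ofReal_le_ofReal
    rw [hh, norm_mul, norm_mul, norm_phaseNV, one_mul, Complex.norm_real,
      Real.norm_of_nonneg (cutNV_nonneg _ _)]
    exact mul_le_of_le_one_left (norm_nonneg _) (cutNV_le_one _ _)
  simp only [e]
  rw [lintegral_neg_eq_self (fun y => ‖FT2 h y‖ₑ ^ 2)]
  refine (lintegral_enorm_FT2_sq_le hm (integrable_propNV_integrand n τ hg 0)).trans ?_
  rw [show (2 * Real.pi) ^ 4 = (2 * Real.pi) ^ 2 * (2 * Real.pi) ^ 2 by ring,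
    ENNReal.ofReal_mul (by positivity), mul_assoc]
  gcongr
  exact hle.trans (lintegral_enorm_FT2_sq_le hg hgi)

open ComplexConjugate in
theorem integral_cutNV_mul_FT2_mul_conj (n : ℕ) (τ : ℝ) {f g : ℝ × ℝ → ℂ} (hf : Measurable f)
    (hfi : Integrable f) (hg : Measurable g) :
    ∫ w, (cutNV n w : ℂ) * (phaseNV τ 0 w * FT2 g w * conj (FT2 f w))
      = ∫ y, propNV n τ g y * conj (f y) := by
  have e : ∀ w, (cutNV n w : ℂ) * (phaseNV τ 0 w * FT2 g w * conj (FT2 f w))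
      = ∫ y, phaseNV τ y w * cutNV n w * FT2 g w * conj (f y) := by
    intro w
    rw [FT2_eq_integral_phaseNV f, ← integral_conj, ← integral_const_mul, ← integral_const_mul]
    congr 1 with y
    rw [map_mul, conj_phaseNV, neg_neg, ← zero_add y, ← add_zero τ, ← phaseNV_mul]
    simp only [zero_add, add_zero, neg_zero]
    ring
  simp only [e]
  rw [integral_integral_swap]
  · simp only [integral_mul_const, propNV]
  · refine (((integrable_propNV_integrand n τ hg 0).norm).mul_prod hfi.norm).mono' ?_ ?_
    · refine (Measurable.mul (Measurable.mul (Measurable.mul ?_ ?_)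
        ((measurable_FT2 hg).comp measurable_fst)) ?_).aestronglyMeasurable
      · exact (continuous_phaseNV.comp (by fun_prop : Continuous fun p : (ℝ × ℝ) × (ℝ × ℝ) =>
          (τ, p.2, p.1))).measurable
      · exact Complex.measurable_ofReal.comp ((measurable_cutNV n).comp measurable_fst)
      · exact Complex.continuous_conj.measurable.comp (hf.comp measurable_snd)
    · refine Filter.Eventually.of_forall fun p => ?_
      simp only [Function.uncurry, norm_mul, norm_phaseNV, one_mul, Complex.norm_conj, le_refl]

theorem lintegral_norm_propNV_rpow_le {q : ℝ} (hq : 2 < q) (n : ℕ) {τ : ℝ} (hτ : τ ≠ 0)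
    {g : ℝ × ℝ → ℂ} (hg : Measurable g) (hgi : Integrable g)
    (hgr : Integrable fun v => ‖g v‖ ^ (q / (q - 1))) :
    ∫⁻ y, ENNReal.ofReal (‖propNV n τ g y‖ ^ q)
      ≤ ENNReal.ofReal (4 * q / (q - 2) * (2 * (56 * |τ| ^ (-(2 / 3) : ℝ))) ^ (q - 2)
        * (∫ x, ‖g x‖ ^ (q / (q - 1))) ^ (q - 1)) * ENNReal.ofReal ((2 * Real.pi) ^ 4) := by
  have := abs_pos.2 hτ
  exact lintegral_norm_rpow_le_of_L1_L2 hq (by positivity)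
    (fun g hg _ => measurable_propNV n τ hg)
    (fun f g hf hfi hg hgi => propNV_add n τ hf hfi hg hgi)
    (fun g hg hgi => norm_propNV_le n hτ hg hgi)
    (fun g hg hgi => lintegral_enorm_propNV_sq_le n τ hg hgi) hg hgi hgr

open ComplexConjugate in
/-- Dispersive pairing estimate. -/
theorem exists_enorm_integral_cutNV_mul_FT2_le {q : ℝ} (hq : 2 < q) :
    ∃ K : ℝ, 0 < K ∧ ∀ (n : ℕ) (τ : ℝ), τ ≠ 0 → ∀ f g : ℝ × ℝ → ℂ, Measurable f → Integrable f →
      Measurable g → Integrable g → (Integrable fun v => ‖g v‖ ^ (q / (q - 1))) →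
      ‖∫ w, (cutNV n w : ℂ) * (phaseNV τ 0 w * FT2 g w * conj (FT2 f w))‖ₑ
        ≤ ENNReal.ofReal K * ENNReal.ofReal (|τ| ^ (-(2 / 3 * ((q - 2) / q))))
          * ((∫⁻ v, ‖g v‖ₑ ^ (q / (q - 1))) ^ ((q - 1) / q)
            * (∫⁻ v, ‖f v‖ₑ ^ (q / (q - 1))) ^ ((q - 1) / q)) := by
  have hq0 : 0 < q := by linarith
  have hq1 : 0 < q - 1 := by linarith
  have hq2 : 0 < q - 2 := by linarith
  refine ⟨(4 * q / (q - 2) * 112 ^ (q - 2) * (2 * Real.pi) ^ 4) ^ (1 / q), by positivity, ?_⟩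
  intro n τ hτ f g hf hfi hg hgi hgr
  have hτ' := abs_pos.2 hτ
  have hN : ENNReal.ofReal (∫ x, ‖g x‖ ^ (q / (q - 1))) = ∫⁻ v, ‖g v‖ₑ ^ (q / (q - 1)) := by
    rw [ofReal_integral_eq_lintegral_ofReal hgr
      (Filter.Eventually.of_forall fun x => by simp only [Pi.zero_apply]; positivity)]
    congr 1 with v
    rw [← ENNReal.ofReal_rpow_of_nonneg (norm_nonneg _) (by positivity), ofReal_norm]
  set N := ∫ x, ‖g x‖ ^ (q / (q - 1)) with hNdef
  have hN0 : 0 ≤ N := integral_nonneg fun x => by positivity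
  have hT := lintegral_norm_propNV_rpow_le hq n hτ hg hgi hgr
  rw [← hNdef, ← ENNReal.ofReal_mul (by positivity)] at hT
  have hT' : ∫⁻ y, ‖propNV n τ g y‖ₑ ^ q = ∫⁻ y, ENNReal.ofReal (‖propNV n τ g y‖ ^ q) := by
    congr 1 with v
    rw [← ENNReal.ofReal_rpow_of_nonneg (norm_nonneg _) (by positivity), ofReal_norm]
  rw [← hT'] at hT
  rw [integral_cutNV_mul_FT2_mul_conj n τ hf hfi hg]
  refine (enorm_integral_le_lintegral_enorm _).trans ?_
  have hc : q.HolderConjugate (q / (q - 1)) := by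
    rw [Real.holderConjugate_iff]
    refine ⟨by linarith, by field_simp; ring⟩
  have ho := ENNReal.lintegral_mul_le_Lp_mul_Lq volume hc
    (measurable_propNV n τ hg).enorm.aemeasurable hf.enorm.aemeasurable
  have e : ∫⁻ y, ‖propNV n τ g y * conj (f y)‖ₑ
      = ∫⁻ y, ((fun y => ‖propNV n τ g y‖ₑ) * (fun y => ‖f y‖ₑ)) y := by
    congr 1 with y
    rw [enorm_mul, RCLike.enorm_conj]; rfl
  rw [e]
  refine ho.trans ?_
  rw [← mul_assoc, one_div_div]
  gcongr
  refine (ENNReal.rpow_le_rpow hT (by positivity)).trans_eq ?_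
  rw [← hN, ENNReal.ofReal_rpow_of_nonneg (by positivity) (by positivity),
    ENNReal.ofReal_rpow_of_nonneg hN0 (by positivity), ← ENNReal.ofReal_mul (by positivity),
    ← ENNReal.ofReal_mul (by positivity)]
  congr 1
  rw [show 4 * q / (q - 2) * (2 * (56 * |τ| ^ (-(2 / 3) : ℝ))) ^ (q - 2) * N ^ (q - 1)
      * (2 * Real.pi) ^ 4 = (4 * q / (q - 2) * 112 ^ (q - 2) * (2 * Real.pi) ^ 4)
        * (|τ| ^ (-(2 / 3) : ℝ)) ^ (q - 2) * N ^ (q - 1) by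
    rw [← mul_assoc, Real.mul_rpow (by norm_num) (by positivity)]; norm_num; ring]
  rw [Real.mul_rpow (by positivity) (by positivity), Real.mul_rpow (by positivity) (by positivity),
    ← Real.rpow_mul hτ'.le, ← Real.rpow_mul hτ'.le, ← Real.rpow_mul hN0]
  congr 2
  · congr 1; ring
  · congr 1; ring

theorem lintegral_comp_abs_eq {F : ℝ → ENNReal} (hF : Measurable F) :
    ∫⁻ s, F |s| = 2 * ∫⁻ s in Set.Ioi 0, F s := by
  have h1 : ∫⁻ s in Set.Ioi (0 : ℝ), F |s| = ∫⁻ s in Set.Ioi 0, F s :=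
    setLIntegral_congr_fun measurableSet_Ioi fun s hs => by rw [abs_of_pos hs]
  have h2 : ∫⁻ s in Set.Iic (0 : ℝ), F |s| = ∫⁻ s in Set.Ioi 0, F s := by
    rw [← h1, ← setLIntegral_congr (Ioi_ae_eq_Ici (a := (0 : ℝ))).symm]
    have := (Measure.measurePreserving_neg (volume : Measure ℝ)).setLIntegral_comp_preimage
      (s := Set.Ici 0) (f := fun s => F |s|) measurableSet_Ici (by fun_prop)
    simpa using this
  rw [← lintegral_add_compl _ (measurableSet_Iic (a := (0 : ℝ))), Set.compl_Iic, h1, h2, two_mul]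

theorem lintegral_near_rpow_le {γ : ℝ} (hγ : γ < 1) {R : ℝ} (hR : 0 ≤ R) (t : ℝ) :
    ∫⁻ s, (Set.Iic R).indicator (fun u => ENNReal.ofReal (u ^ (-γ))) |s - t|
      = ENNReal.ofReal (2 / (1 - γ) * R ^ (1 - γ)) := by
  have hm : Measurable ((Set.Iic R).indicator (fun u => ENNReal.ofReal (u ^ (-γ)))) :=
    Measurable.indicator (by fun_prop) measurableSet_Iic
  rw [lintegral_sub_right_eq_self
    (fun s => (Set.Iic R).indicator (fun u => ENNReal.ofReal (u ^ (-γ))) |s|),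
    lintegral_comp_abs_eq hm, setLIntegral_indicator measurableSet_Iic, Set.inter_comm,
    Set.Ioi_inter_Iic, ← ofReal_integral_eq_lintegral_ofReal,
    ← intervalIntegral.integral_of_le hR, integral_rpow (Or.inl (by linarith)),
    Real.zero_rpow (by linarith), ← ENNReal.ofReal_ofNat, ← ENNReal.ofReal_mul (by norm_num)]
  · congr 1
    rw [show -γ + 1 = 1 - γ by ring]
    ring
  · change IntegrableOn _ _ _
    rw [← intervalIntegrable_iff_integrableOn_Ioc_of_le hR]
    exact intervalIntegral.intervalIntegrable_rpow' (by linarith)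
  · refine (ae_restrict_mem measurableSet_Ioc).mono fun s hs => ?_
    have := hs.1
    simp only [Pi.zero_apply]
    positivity

theorem lintegral_far_rpow_le {R : ℝ} (hR : 0 < R) (t : ℝ) :
    ∫⁻ s, (Set.Ioi R).indicator (fun u => ENNReal.ofReal (u ^ (-2 : ℝ))) |s - t|
      = ENNReal.ofReal (2 * R⁻¹) := by
  have hm : Measurable ((Set.Ioi R).indicator (fun u => ENNReal.ofReal (u ^ (-2 : ℝ)))) :=
    Measurable.indicator (by fun_prop) measurableSet_Ioi
  rw [lintegral_sub_right_eq_self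
    (fun s => (Set.Ioi R).indicator (fun u => ENNReal.ofReal (u ^ (-2 : ℝ))) |s|),
    lintegral_comp_abs_eq hm, setLIntegral_indicator measurableSet_Ioi,
    Set.Ioi_inter_Ioi, max_eq_left hR.le, ← ofReal_integral_eq_lintegral_ofReal,
    integral_Ioi_rpow_of_lt (by norm_num) hR, ← ENNReal.ofReal_ofNat,
    ← ENNReal.ofReal_mul (by norm_num)]
  · congr 1
    rw [show (-2 : ℝ) + 1 = -1 by norm_num, Real.rpow_neg_one]
    ring
  · exact integrableOn_Ioi_rpow_of_lt (by norm_num) hR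
  · refine (ae_restrict_mem measurableSet_Ioi).mono fun s hs => ?_
    have := hR.trans hs
    simp only [Pi.zero_apply]
    positivity

theorem lintegral_rpow_mul_truncation_le {p : ℝ} (hp : 2 < p) {h : ℝ → ENNReal} (hh : Measurable h)
    {N a : ℝ} (hN : 0 < N) (ha : 0 < a) (hhN : ∫⁻ s, h s ^ (p / (p - 1)) ≤ ENNReal.ofReal N) (t : ℝ) :
    ∫⁻ s, ENNReal.ofReal (|s - t| ^ (-(2 / p))) * {s | h s ≤ ENNReal.ofReal a}.indicator h s
      ≤ ENNReal.ofReal ((2 / (1 - 2 / p) + 2 ^ (1 / p)) * N ^ (1 - 2 / p) * a ^ (1 / (p - 1))) := by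
  have hp0 : 0 < p := by linarith
  have hp1 : 0 < p - 1 := by linarith
  have hγ : 2 / p < 1 := by rw [div_lt_one hp0]; exact hp
  have hγ' : 0 < 1 - 2 / p := by linarith
  set R := N * a ^ (-(p / (p - 1))) with hR
  have hR0 : 0 < R := by positivity
  set k : ℝ → ENNReal := (Set.Ioi R).indicator (fun u => ENNReal.ofReal (u ^ (-(2 / p)))) with hk
  have hkm : Measurable k := Measurable.indicator (by fun_prop) measurableSet_Ioi
  have hnm : Measurable ((Set.Iic R).indicator (fun u : ℝ => ENNReal.ofReal (u ^ (-(2 / p))))) :=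
    Measurable.indicator (by fun_prop) measurableSet_Iic
  have pw : ∀ s, ENNReal.ofReal (|s - t| ^ (-(2 / p))) * {s | h s ≤ ENNReal.ofReal a}.indicator h s
      ≤ (Set.Iic R).indicator (fun u => ENNReal.ofReal (u ^ (-(2 / p)))) |s - t| * ENNReal.ofReal a
        + k |s - t| * h s := by
    intro s
    by_cases hs : |s - t| ≤ R
    · refine le_add_right ?_
      rw [Set.indicator_of_mem (s := Set.Iic R) hs]
      gcongr
      refine Set.indicator_apply_le' (fun h => h) fun _ => zero_le
    · refine le_add_left ?_
      rw [hk, Set.indicator_of_mem (s := Set.Ioi R) (not_le.1 hs)]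
      gcongr
      exact Set.indicator_le_self _ _ _
  refine (lintegral_mono pw).trans ?_
  rw [lintegral_add_right _ (by fun_prop), lintegral_mul_const' _ _ (by simp),
    lintegral_near_rpow_le hγ hR0.le]
  have hc : p.HolderConjugate (p / (p - 1)) := by
    rw [Real.holderConjugate_iff]
    refine ⟨by linarith, by field_simp; ring⟩
  have ho := ENNReal.lintegral_mul_le_Lp_mul_Lq volume hc
    (f := fun s => k |s - t|) (g := h) (by fun_prop) hh.aemeasurable
  have ek : ∀ s, k |s - t| ^ p
      = (Set.Ioi R).indicator (fun u => ENNReal.ofReal (u ^ (-2 : ℝ))) |s - t| := by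
    intro s
    simp only [hk, Set.indicator]
    split_ifs with hs
    · rw [ENNReal.ofReal_rpow_of_nonneg (by positivity) hp0.le, ← Real.rpow_mul (abs_nonneg _)]
      congr 2
      field_simp
    · exact ENNReal.zero_rpow_of_pos hp0
  simp only [ek] at ho
  rw [lintegral_far_rpow_le hR0, one_div_div] at ho
  have ho2 := ho.trans (mul_le_mul_right (ENNReal.rpow_le_rpow hhN (by positivity)) _)
  refine (add_le_add_right ho2 _).trans ?_
  rw [ENNReal.ofReal_rpow_of_nonneg (by positivity) (by positivity),
    ENNReal.ofReal_rpow_of_nonneg hN.le (by positivity), ← ENNReal.ofReal_mul (by positivity),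
    ← ENNReal.ofReal_mul (by positivity), ← ENNReal.ofReal_add (by positivity) (by positivity)]
  apply ENNReal.ofReal_le_ofReal
  apply le_of_eq
  have e1 : R ^ (1 - 2 / p) * a = N ^ (1 - 2 / p) * a ^ (1 / (p - 1)) := by
    rw [hR, Real.mul_rpow hN.le (by positivity), ← Real.rpow_mul ha.le, mul_assoc]
    nth_rw 2 [← Real.rpow_one a]
    rw [← Real.rpow_add ha]
    congr 2
    field_simp
    ring
  have e2 : (2 * R⁻¹) ^ (1 / p) * N ^ ((p - 1) / p)
      = 2 ^ (1 / p) * (N ^ (1 - 2 / p) * a ^ (1 / (p - 1))) := by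
    rw [Real.mul_rpow (by norm_num) (by positivity), hR, mul_inv, ← Real.rpow_neg ha.le, neg_neg,
      Real.mul_rpow (by positivity) (by positivity), ← Real.rpow_mul ha.le, ← Real.rpow_neg_one,
      ← Real.rpow_mul hN.le, show 1 - 2 / p = -1 * (1 / p) + (p - 1) / p by field_simp; ring,
      Real.rpow_add hN]
    rw [show p / (p - 1) * (1 / p) = 1 / (p - 1) by field_simp]
    ring
  rw [mul_assoc, e1, e2]
  ring

/-- Hardy–Littlewood–Sobolev on the line, in bilinear diagonal form. -/
theorem exists_lintegral_lintegral_rpow_mul_mul_le {p : ℝ} (hp : 2 < p) :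
    ∃ C : ℝ, 0 < C ∧ ∀ h : ℝ → ENNReal, Measurable h → (∀ t, h t ≠ ⊤) →
      ∫⁻ s, ∫⁻ t, ENNReal.ofReal (|s - t| ^ (-(2 / p))) * (h s * h t)
        ≤ ENNReal.ofReal C * (∫⁻ s, h s ^ (p / (p - 1))) ^ (2 * (p - 1) / p) := by
  have hp0 : 0 < p := by linarith
  have hp1 : 0 < p - 1 := by linarith
  have hγ : 2 / p < 1 := by rw [div_lt_one hp0]; exact hp
  have hγ' : 0 < 1 - 2 / p := by linarith
  set c := 2 / (1 - 2 / p) + (2 : ℝ) ^ (1 / p) with hc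
  have hc0 : 0 < c := by positivity
  refine ⟨2 * c, by positivity, fun h hh htop => ?_⟩
  set M := ∫⁻ s, h s ^ (p / (p - 1)) with hM
  rcases eq_or_ne M ⊤ with hMt | hMt
  · rw [hMt, ENNReal.top_rpow_of_pos (by positivity), ENNReal.mul_top (by simpa using hc0)]
    exact le_top
  rcases eq_or_ne M 0 with hM0 | hM0
  · rw [hM, lintegral_eq_zero_iff (by fun_prop)] at hM0
    have hz : ∀ᵐ t, h t = 0 := hM0.mono fun t ht => by
      simpa [ENNReal.rpow_eq_zero_iff, hp0, hp1, not_lt.2 (div_pos hp0 hp1).le, htop] using ht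
    have : ∀ s, ∫⁻ t, ENNReal.ofReal (|s - t| ^ (-(2 / p))) * (h s * h t) = 0 := by
      intro s
      rw [lintegral_eq_zero_iff (by fun_prop)]
      exact hz.mono fun t ht => by simp [ht]
    simp [this]
  set N := M.toReal with hN
  have hN0 : 0 < N := ENNReal.toReal_pos hM0 hMt
  have hNM : ENNReal.ofReal N = M := ENNReal.ofReal_toReal hMt
  set Φ : ℝ → ℝ → ENNReal := fun s t =>
    h t * (ENNReal.ofReal (|s - t| ^ (-(2 / p))) * {s | h s ≤ h t}.indicator h s) with hΦ
  have hΦm : Measurable fun z : ℝ × ℝ => Φ z.1 z.2 := by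
    refine Measurable.mul (by fun_prop) (Measurable.mul (by fun_prop) ?_)
    exact Measurable.indicator (f := fun z : ℝ × ℝ => h z.1) (s := {z : ℝ × ℝ | h z.1 ≤ h z.2})
      (by fun_prop) (measurableSet_le (by fun_prop) (by fun_prop))
  have hΦm' : Measurable fun z : ℝ × ℝ => Φ z.2 z.1 := hΦm.comp measurable_swap
  have main : ∫⁻ t, ∫⁻ s, Φ s t ≤ ENNReal.ofReal c * M ^ (2 * (p - 1) / p) := by
    have inner : ∀ t, ∫⁻ s, Φ s t
        ≤ ENNReal.ofReal (c * N ^ (1 - 2 / p)) * h t ^ (p / (p - 1)) := by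
      intro t
      rw [lintegral_const_mul _ (by
        refine Measurable.mul (by fun_prop) ?_
        exact hh.indicator (measurableSet_le hh measurable_const))]
      rcases eq_or_ne (h t) 0 with h0 | h0
      · rw [h0, zero_mul]; exact zero_le
      have ha0 := ENNReal.toReal_pos h0 (htop t)
      have hat := ENNReal.ofReal_toReal (htop t)
      set a := (h t).toReal with ha
      rw [← hat]
      refine (mul_le_mul_right
        (lintegral_rpow_mul_truncation_le hp hh hN0 ha0 hNM.ge t) _).trans_eq ?_
      rw [← ENNReal.ofReal_mul ha0.le, ENNReal.ofReal_rpow_of_nonneg ha0.le (by positivity),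
        ← ENNReal.ofReal_mul (by positivity)]
      congr 1
      rw [show p / (p - 1) = 1 + 1 / (p - 1) by field_simp; ring, Real.rpow_add ha0, Real.rpow_one]
      ring
    refine (lintegral_mono inner).trans_eq ?_
    rw [lintegral_const_mul' _ _ (by simp), ← hM, ← hNM, ENNReal.ofReal_rpow_of_nonneg hN0.le
      (by positivity), ← ENNReal.ofReal_mul (by positivity), ← ENNReal.ofReal_mul hc0.le]
    congr 1
    rw [show 2 * (p - 1) / p = 1 - 2 / p + 1 by field_simp; ring, Real.rpow_add hN0, Real.rpow_one]
    ring
  calc ∫⁻ s, ∫⁻ t, ENNReal.ofReal (|s - t| ^ (-(2 / p))) * (h s * h t)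
      ≤ ∫⁻ s, ∫⁻ t, (Φ s t + Φ t s) := by
        gcongr with s t
        rcases le_total (h s) (h t) with hst | hst
        · refine le_add_right (le_of_eq ?_)
          simp only [hΦ]
          rw [Set.indicator_of_mem (by exact hst)]
          ring
        · refine le_add_left (le_of_eq ?_)
          simp only [hΦ]
          rw [Set.indicator_of_mem (by exact hst), abs_sub_comm]
          ring
    _ = (∫⁻ s, ∫⁻ t, Φ s t) + ∫⁻ s, ∫⁻ t, Φ t s := by
        rw [← lintegral_add_left]
        · congr 1 with s
          exact lintegral_add_left (hΦm.comp measurable_prodMk_left) _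
        · exact hΦm.lintegral_prod_right'
    _ ≤ ENNReal.ofReal c * M ^ (2 * (p - 1) / p) + ENNReal.ofReal c * M ^ (2 * (p - 1) / p) := by
        gcongr
        rw [lintegral_lintegral_swap hΦm.aemeasurable]
        exact main
    _ = _ := by rw [ENNReal.ofReal_mul (by norm_num), ENNReal.ofReal_ofNat]; ring

theorem measurable_uncurry_phaseNV_mul_FT2 {F : ℝ → ℝ × ℝ → ℂ}
    (hF : Measurable (Function.uncurry F)) :
    Measurable (Function.uncurry fun s w => phaseNV s 0 w * FT2 (F s) w) := by
  refine Measurable.mul (continuous_phaseNV.comp (by fun_prop : Continuous fun z : ℝ × (ℝ × ℝ) =>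
    (z.1, (0 : ℝ × ℝ), z.2))).measurable ?_
  have : Measurable (Function.uncurry fun (z : ℝ × (ℝ × ℝ)) v =>
      phaseNV 0 (-v) z.2 * F z.1 v) := by
    refine Measurable.mul (continuous_phaseNV.comp (by fun_prop :
      Continuous fun z : (ℝ × (ℝ × ℝ)) × (ℝ × ℝ) => ((0 : ℝ), -z.2, z.1.2))).measurable ?_
    exact hF.comp (by fun_prop : Measurable fun z : (ℝ × (ℝ × ℝ)) × (ℝ × ℝ) => (z.1.1, z.2))
  convert (this.stronglyMeasurable.integral_prod_right (ν := volume)).measurable using 1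
  ext z
  exact FT2_eq_integral_phaseNV _ _

/-- Dual Strichartz estimate, on the Fourier side. -/
theorem exists_lintegral_enorm_integral_phaseNV_mul_FT2_sq_le {p q : ℝ} (hp : 2 < p) (hq : 2 < q)
    (hpq : 2 / 3 * ((q - 2) / q) = 2 / p) :
    ∃ C : ℝ, 0 < C ∧ ∀ (F : ℝ → ℝ × ℝ → ℂ) (c : ℝ → ℝ), Measurable (Function.uncurry F) →
      (∀ s, Integrable (F s)) → (∀ s, Integrable fun v => ‖F s v‖ ^ (q / (q - 1))) →
      Integrable c → (∀ s, ∫ v, ‖F s v‖ ≤ c s) →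
      ∫⁻ w, ‖∫ s, phaseNV s 0 w * FT2 (F s) w‖ₑ ^ 2
        ≤ ENNReal.ofReal C * (∫⁻ s, ((∫⁻ v, ‖F s v‖ₑ ^ (q / (q - 1))) ^ ((q - 1) / q))
          ^ (p / (p - 1))) ^ (2 * (p - 1) / p) := by
  have hq1 : 0 < q - 1 := by linarith
  have hq0 : 0 < q := by linarith
  obtain ⟨K, hK, hpair⟩ := exists_enorm_integral_cutNV_mul_FT2_le hq
  obtain ⟨C, hC, hls⟩ := exists_lintegral_lintegral_rpow_mul_mul_le hp
  rw [hpq] at hpair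
  refine ⟨K * C, by positivity, fun F c hF hFi hFr hc hFc => ?_⟩
  set h : ℝ → ENNReal := fun s => (∫⁻ v, ‖F s v‖ₑ ^ (q / (q - 1))) ^ ((q - 1) / q) with hh
  have hFs : ∀ s, Measurable (F s) := fun s => hF.comp measurable_prodMk_left
  have hhm : Measurable h := by
    refine Measurable.pow_const ?_ _
    exact Measurable.lintegral_prod_right' (f := fun z : ℝ × (ℝ × ℝ) =>
      ‖Function.uncurry F z‖ₑ ^ (q / (q - 1))) (by fun_prop)
  have hht : ∀ s, h s ≠ ⊤ := by
    intro s
    refine ENNReal.rpow_ne_top_of_nonneg (by positivity) ?_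
    have := (hFr s).hasFiniteIntegral
    refine (ne_of_lt ?_ : (_ : ENNReal) ≠ ⊤)
    refine lt_of_eq_of_lt ?_ this
    congr 1 with v
    rw [← ofReal_norm, ENNReal.ofReal_rpow_of_nonneg (norm_nonneg _) (by positivity),
      Real.enorm_of_nonneg (by positivity)]
  have hHm := measurable_uncurry_phaseNV_mul_FT2 hF
  refine lintegral_le_of_tendsto_one measurable_cutNV tendsto_cutNV ?_ fun n => ?_
  · exact (hHm.stronglyMeasurable.integral_prod_left (μ := volume)).measurable.enorm.pow_const 2
  refine (lintegral_mul_enorm_integral_sq_le hHm hc ?_ (integrable_cutNV n)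
    (cutNV_nonneg n)).trans ?_
  · intro s w
    rw [norm_mul, norm_phaseNV, one_mul]
    exact (norm_FT2_le _ _).trans (hFc s)
  calc _ ≤ ∫⁻ s, ∫⁻ t, ENNReal.ofReal K * (ENNReal.ofReal (|s - t| ^ (-(2 / p))) * (h s * h t)) := by
        refine lintegral_mono fun s => lintegral_mono_ae ?_
        filter_upwards [compl_mem_ae_iff.2 (measure_singleton s)] with t ht
        have hst : s - t ≠ 0 := sub_ne_zero.2 fun h => ht h.symm
        have := hpair n (s - t) hst (F t) (F s) (hFs t) (hFi t) (hFs s) (hFi s) (hFr s)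
        rw [← mul_assoc]
        refine le_of_eq_of_le ?_ this
        congr 2 with w
        rw [map_mul, conj_phaseNV, neg_zero, sub_eq_add_neg, ← zero_add (0 : ℝ × ℝ), ← phaseNV_mul,
          zero_add]
        ring
    _ = ENNReal.ofReal K * ∫⁻ s, ∫⁻ t, ENNReal.ofReal (|s - t| ^ (-(2 / p))) * (h s * h t) := by
        rw [← lintegral_const_mul' _ _ (by simp)]
        congr 1 with s
        rw [lintegral_const_mul' _ _ (by simp)]
    _ ≤ _ := by
        rw [ENNReal.ofReal_mul hK.le, mul_assoc]
        gcongr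
        exact hls h hhm hht

theorem Uphi_eq_integral_phaseNV (t : ℝ) (u : ℝ × ℝ → ℂ) (v : ℝ × ℝ) :
    Uphi t u v = (2 * Real.pi : ℂ)⁻¹ ^ 2 * ∫ w, phaseNV (-t) v w * FT2 u w := by
  rw [Uphi]
  congr 2 with w
  rw [phaseNV]
  congr 2
  push_cast
  ring

theorem measurable_uncurry_Uphi {u : ℝ × ℝ → ℂ} (hu : Measurable u) :
    Measurable (Function.uncurry fun t v => Uphi t u v) := by
  have : Measurable (Function.uncurry fun (z : ℝ × (ℝ × ℝ)) w =>
      phaseNV (-z.1) z.2 w * FT2 u w) := by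
    refine Measurable.mul (continuous_phaseNV.comp (by fun_prop :
      Continuous fun z : (ℝ × (ℝ × ℝ)) × (ℝ × ℝ) => (-z.1.1, z.1.2, z.2))).measurable ?_
    exact (measurable_FT2 hu).comp measurable_snd
  have h := (this.stronglyMeasurable.integral_prod_right (ν := volume)).measurable
  convert h.const_mul ((2 * Real.pi : ℂ)⁻¹ ^ 2) using 1
  ext z
  exact Uphi_eq_integral_phaseNV _ _ _

theorem norm_two_pi_inv_sq : ‖(2 * Real.pi : ℂ)⁻¹ ^ 2‖ = ((2 * Real.pi) ^ 2)⁻¹ := by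
  rw [norm_pow, norm_inv, norm_mul, Complex.norm_real, Real.norm_of_nonneg Real.pi_pos.le, inv_pow]
  simp

theorem norm_Uphi_le (t : ℝ) (u : ℝ × ℝ → ℂ) (v : ℝ × ℝ) :
    ‖Uphi t u v‖ ≤ ((2 * Real.pi) ^ 2)⁻¹ * ∫ w, ‖FT2 u w‖ := by
  rw [Uphi_eq_integral_phaseNV, norm_mul, norm_two_pi_inv_sq]
  gcongr
  refine (norm_integral_le_integral_norm _).trans_eq ?_
  simp only [norm_mul, norm_phaseNV, one_mul]

theorem Uphi_eq_zero_of_not_integrable {u : ℝ × ℝ → ℂ} (hu : Measurable u)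
    (h : ¬ Integrable (FT2 u)) (t : ℝ) (v : ℝ × ℝ) : Uphi t u v = 0 := by
  rw [Uphi_eq_integral_phaseNV, integral_undef, mul_zero]
  intro hi
  refine h ⟨(measurable_FT2 hu).aestronglyMeasurable, ?_⟩
  refine hi.hasFiniteIntegral.congr' (Filter.Eventually.of_forall fun w => ?_)
  rw [norm_mul, norm_phaseNV, one_mul]

open ComplexConjugate in
theorem integral_Uphi_mul_conj {u : ℝ × ℝ → ℂ} (hu : Measurable u) (hui : Integrable (FT2 u))
    {F : ℝ → ℝ × ℝ → ℂ} (hF : Measurable (Function.uncurry F))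
    (hFi : Integrable (Function.uncurry F)) :
    ∫ z : ℝ × (ℝ × ℝ), Uphi z.1 u z.2 * conj (F z.1 z.2)
      = (2 * Real.pi : ℂ)⁻¹ ^ 2
        * ∫ w, FT2 u w * conj (∫ s, phaseNV s 0 w * FT2 (F s) w) := by
  have e : ∀ z : ℝ × (ℝ × ℝ), Uphi z.1 u z.2 * conj (F z.1 z.2) = (2 * Real.pi : ℂ)⁻¹ ^ 2
      * ∫ w, phaseNV (-z.1) z.2 w * FT2 u w * conj (F z.1 z.2) := by
    intro z
    rw [Uphi_eq_integral_phaseNV, integral_mul_const, mul_assoc]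
  simp only [e]
  rw [integral_const_mul, integral_integral_swap]
  · congr 2 with w
    have e2 : ∀ z : ℝ × (ℝ × ℝ), phaseNV (-z.1) z.2 w * FT2 u w * conj (F z.1 z.2)
        = FT2 u w * conj (phaseNV z.1 (-z.2) w * F z.1 z.2) := by
      intro z
      rw [map_mul, conj_phaseNV, neg_neg]
      ring
    simp only [e2]
    rw [integral_const_mul, integral_conj]
    congr 2
    rw [Measure.volume_eq_prod, integral_prod]
    · congr 1 with s
      rw [FT2_eq_integral_phaseNV, ← integral_const_mul]
      congr 1 with v
      rw [← mul_assoc, phaseNV_mul, add_zero, zero_add]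
    · refine hFi.bdd_mul (c := 1) ?_ (Filter.Eventually.of_forall fun z => (norm_phaseNV _ _ _).le)
      exact (continuous_phaseNV.comp (by fun_prop : Continuous fun z : ℝ × (ℝ × ℝ) =>
        (z.1, -z.2, w))).aestronglyMeasurable
  · refine (hFi.norm.mul_prod hui.norm).mono' ?_ ?_
    · refine (Measurable.mul (Measurable.mul ?_ ((measurable_FT2 hu).comp measurable_snd))
        ?_).aestronglyMeasurable
      · exact (continuous_phaseNV.comp (by fun_prop : Continuous fun z : (ℝ × (ℝ × ℝ)) × (ℝ × ℝ) =>
          (-z.1.1, z.1.2, z.2))).measurable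
      · exact Complex.continuous_conj.measurable.comp (hF.comp measurable_fst)
    · refine Filter.Eventually.of_forall fun z => ?_
      simp only [Function.uncurry, norm_mul, norm_phaseNV, one_mul, Complex.norm_conj]
      rw [mul_comm]

open ComplexConjugate in
/-- Strichartz estimate tested against bounded, boundedly supported functions. -/
theorem exists_enorm_integral_Uphi_mul_conj_le {p q : ℝ} (hp : 2 < p) (hq : 2 < q)
    (hpq : 2 / 3 * ((q - 2) / q) = 2 / p) :
    ∃ C : ℝ, 0 < C ∧ ∀ u : ℝ × ℝ → ℂ, Measurable u → Integrable u → Integrable (FT2 u) →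
      ∀ (F : ℝ → ℝ × ℝ → ℂ) (M R : ℝ), Measurable (Function.uncurry F) →
      (∀ s v, ‖F s v‖ ≤ (Set.Icc (-R) R).indicator (fun _ => M) s
        * (Metric.closedBall 0 R).indicator (fun _ => 1) v) →
      ‖∫ z : ℝ × (ℝ × ℝ), Uphi z.1 u z.2 * conj (F z.1 z.2)‖ₑ
        ≤ ENNReal.ofReal C * (∫⁻ v, ‖u v‖ₑ ^ 2) ^ ((1 : ℝ) / 2)
          * (∫⁻ s, ((∫⁻ v, ‖F s v‖ₑ ^ (q / (q - 1))) ^ ((q - 1) / q))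
          ^ (p / (p - 1))) ^ ((p - 1) / p) := by
  have hq1 : 0 < q - 1 := by linarith
  have hq0 : 0 < q := by linarith
  have hp1 : 0 < p - 1 := by linarith
  have hp0 : 0 < p := by linarith
  obtain ⟨C, hC, hd⟩ := exists_lintegral_enorm_integral_phaseNV_mul_FT2_sq_le hp hq hpq
  refine ⟨((2 * Real.pi) ^ 2)⁻¹ * ((2 * Real.pi) ^ 2) ^ ((1 : ℝ) / 2) * C ^ ((1 : ℝ) / 2),
    by positivity, ?_⟩
  intro u hu hui hFu F M R hF hb
  set I : ℝ → ℝ := (Set.Icc (-R) R).indicator (fun _ => M) with hI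
  set B : ℝ × ℝ → ℝ := (Metric.closedBall 0 R).indicator (fun _ => 1) with hB
  have hIi : Integrable I := by
    rw [hI, integrable_indicator_iff measurableSet_Icc]
    exact integrableOn_const (by simp)
  have hBi : Integrable B := by
    rw [hB, integrable_indicator_iff measurableSet_closedBall]
    exact integrableOn_const (measure_closedBall_lt_top.ne)
  have hFs : ∀ s, Measurable (F s) := fun s => hF.comp measurable_prodMk_left
  have hFi : Integrable (Function.uncurry F) :=
    (hIi.mul_prod hBi).mono' hF.aestronglyMeasurable
      (Filter.Eventually.of_forall fun z => hb z.1 z.2)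
  have hFsi : ∀ s, Integrable (F s) := fun s =>
    (hBi.const_mul (I s)).mono' (hFs s).aestronglyMeasurable (Filter.Eventually.of_forall (hb s))
  have hFr : ∀ s, Integrable fun v => ‖F s v‖ ^ (q / (q - 1)) := by
    intro s
    refine (hBi.const_mul (|I s| ^ (q / (q - 1)))).mono'
      ((hFs s).norm.pow_const _).aestronglyMeasurable (Filter.Eventually.of_forall fun v => ?_)
    rw [Real.norm_of_nonneg (by positivity)]
    have h := hb s v
    simp only [hB, Set.indicator] at h ⊢
    split_ifs at h ⊢
    · rw [mul_one] at h ⊢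
      gcongr
      exact h.trans (le_abs_self _)
    · rw [mul_zero] at h ⊢
      rw [le_antisymm h (norm_nonneg _), Real.zero_rpow (by positivity)]
  have hmain := hd F (fun s => I s * ∫ v, B v) hF hFsi hFr (hIi.mul_const _) (fun s => by
    rw [← integral_const_mul]
    exact integral_mono (hFsi s).norm (hBi.const_mul _) (hb s))
  set X := ∫⁻ s, ((∫⁻ v, ‖F s v‖ₑ ^ (q / (q - 1))) ^ ((q - 1) / q)) ^ (p / (p - 1)) with hX
  set G : ℝ × ℝ → ℂ := fun w => ∫ s, phaseNV s 0 w * FT2 (F s) w with hG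
  have hGm : Measurable G :=
    ((measurable_uncurry_phaseNV_mul_FT2 hF).stronglyMeasurable.integral_prod_left
      (μ := volume)).measurable
  rw [integral_Uphi_mul_conj hu hFu hF hFi, enorm_mul, ← ofReal_norm, norm_two_pi_inv_sq]
  have h1 : ‖∫ w, FT2 u w * conj (G w)‖ₑ
      ≤ (∫⁻ w, ‖FT2 u w‖ₑ ^ (2 : ℝ)) ^ ((1 : ℝ) / 2) * (∫⁻ w, ‖G w‖ₑ ^ (2 : ℝ)) ^ ((1 : ℝ) / 2) := by
    refine (enorm_integral_le_lintegral_enorm _).trans ?_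
    simp only [enorm_mul, RCLike.enorm_conj]
    exact ENNReal.lintegral_mul_le_Lp_mul_Lq volume Real.HolderConjugate.two_two
      (measurable_FT2 hu).enorm.aemeasurable hGm.enorm.aemeasurable
  simp only [ENNReal.rpow_two] at h1
  have h2 := h1.trans (mul_le_mul'
    (ENNReal.rpow_le_rpow (lintegral_enorm_FT2_sq_le hu hui) (by norm_num : (0 : ℝ) ≤ 1 / 2))
    (ENNReal.rpow_le_rpow hmain (by norm_num : (0 : ℝ) ≤ 1 / 2)))
  refine (mul_le_mul_right h2 _).trans_eq ?_
  rw [ENNReal.mul_rpow_of_nonneg _ _ (by norm_num), ENNReal.mul_rpow_of_nonneg _ _ (by norm_num),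
    ENNReal.ofReal_rpow_of_nonneg (by positivity) (by norm_num),
    ENNReal.ofReal_rpow_of_nonneg hC.le (by norm_num), ← ENNReal.rpow_mul,
    ENNReal.ofReal_mul (by positivity), ENNReal.ofReal_mul (by positivity),
    show 2 * (p - 1) / p * (1 / 2) = (p - 1) / p by ring]
  ring

open ComplexConjugate in
/-- Truncated form of the duality characterisation of mixed norms. -/
theorem lintegral_truncation_le_of_dual {u : ℝ → ℝ × ℝ → ℂ} (hu : Measurable (Function.uncurry u))
    {M : ℝ} (hM : ∀ t v, ‖u t v‖ ≤ M) {p q : ℝ} (hp : 1 < p) (hq : 1 < q) {K : ENNReal}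
    (h : ∀ (F : ℝ → ℝ × ℝ → ℂ) (M R : ℝ), Measurable (Function.uncurry F) →
      (∀ s v, ‖F s v‖ ≤ (Set.Icc (-R) R).indicator (fun _ => M) s
        * (Metric.closedBall 0 R).indicator (fun _ => 1) v) →
      ‖∫ z : ℝ × (ℝ × ℝ), u z.1 z.2 * conj (F z.1 z.2)‖ₑ
        ≤ K * (∫⁻ s, ((∫⁻ v, ‖F s v‖ₑ ^ (q / (q - 1))) ^ ((q - 1) / q))
          ^ (p / (p - 1))) ^ ((p - 1) / p))
    {R ε : ℝ} (hε : 0 < ε) :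
    ∫⁻ t, {t : ℝ | |t| ≤ R ∧ ENNReal.ofReal ε
        ≤ ∫⁻ v in Metric.closedBall (0 : ℝ × ℝ) R, ‖u t v‖ₑ ^ q}.indicator
      (fun t => (∫⁻ v in Metric.closedBall (0 : ℝ × ℝ) R, ‖u t v‖ₑ ^ q) ^ (p / q)) t ≤ K ^ p := by
  have hp0 : 0 < p := by linarith
  have hq0 : 0 < q := by linarith
  have hp1 : 0 < p - 1 := by linarith
  have hq1 : 0 < q - 1 := by linarith
  have hM0 : 0 ≤ M := (norm_nonneg _).trans (hM 0 0)
  set B : Set (ℝ × ℝ) := Metric.closedBall 0 R with hB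
  have hBm : MeasurableSet B := measurableSet_closedBall
  have hut : ∀ t, Measurable (u t) := fun t => hu.comp measurable_prodMk_left
  set b : ℝ → ENNReal := fun t => ∫⁻ v in B, ‖u t v‖ₑ ^ q with hb
  have hbm : Measurable b := by
    exact Measurable.lintegral_prod_right' (f := fun z : ℝ × (ℝ × ℝ) =>
      ‖Function.uncurry u z‖ₑ ^ q) (by fun_prop)
  set S : Set ℝ := {t : ℝ | |t| ≤ R ∧ ENNReal.ofReal ε ≤ b t} with hS
  have hSm : MeasurableSet S :=
    MeasurableSet.inter (s₁ := {t | |t| ≤ R}) (s₂ := {t | ENNReal.ofReal ε ≤ b t})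
      (measurableSet_le measurable_norm measurable_const) (measurableSet_le measurable_const hbm)
  change ∫⁻ t, S.indicator (fun t => b t ^ (p / q)) t ≤ K ^ p
  set L : ENNReal := ENNReal.ofReal M ^ q * volume B with hL
  have hLt : L ≠ ⊤ := ENNReal.mul_ne_top (by simp [hq0.le]) measure_closedBall_lt_top.ne
  have hbL : ∀ t, b t ≤ L := by
    intro t
    refine (setLIntegral_mono measurable_const (g := fun _ => ENNReal.ofReal M ^ q)
      fun v _ => ?_).trans_eq (by rw [setLIntegral_const])
    gcongr
    rw [← ofReal_norm]
    exact ENNReal.ofReal_le_ofReal (hM t v)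
  have hbt : ∀ t, b t ≠ ⊤ := fun t => ne_top_of_le_ne_top hLt (hbL t)
  have hb0 : ∀ t ∈ S, b t ≠ 0 := fun t ht =>
    ((ENNReal.ofReal_pos.2 hε).trans_le ht.2).ne'
  set A := ∫⁻ t, S.indicator (fun t => b t ^ (p / q)) t with hA
  have hAt : A ≠ ⊤ := by
    refine ne_top_of_le_ne_top (b := L ^ (p / q) * volume (Set.Icc (-R) R)) ?_ ?_
    · exact ENNReal.mul_ne_top (ENNReal.rpow_ne_top_of_nonneg (by positivity) hLt) (by simp)
    · rw [hA, ← setLIntegral_const, ← lintegral_indicator measurableSet_Icc]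
      gcongr with t
      by_cases ht : t ∈ S
      · rw [Set.indicator_of_mem ht, Set.indicator_of_mem (show t ∈ Set.Icc (-R) R from abs_le.1 ht.1)]
        exact ENNReal.rpow_le_rpow (hbL t) (by positivity)
      · rw [Set.indicator_of_notMem ht]
        exact zero_le
  set e := (p - q) / q with he
  set F : ℝ → ℝ × ℝ → ℂ := fun t v => ((S.indicator (fun t => (b t).toReal ^ e) t
    * B.indicator (fun v => ‖u t v‖ ^ (q - 2)) v : ℝ) : ℂ) * u t v with hF
  have hFm : Measurable (Function.uncurry F) := by
    refine Measurable.mul (Complex.measurable_ofReal.comp (Measurable.mul ?_ ?_)) hu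
    · have : Measurable (S.indicator (fun t => (b t).toReal ^ e)) :=
        Measurable.indicator (by fun_prop) hSm
      exact this.comp measurable_fst
    · exact Measurable.indicator (f := fun z : ℝ × (ℝ × ℝ) => ‖Function.uncurry u z‖ ^ (q - 2))
        (s := Prod.snd ⁻¹' B) (by fun_prop) (measurable_snd hBm)
  have hpow : ∀ x : ℝ, 0 ≤ x → x ^ (q - 2) * x = x ^ (q - 1) := by
    intro x hx
    rcases hx.eq_or_lt with rfl | hx
    · rw [mul_zero, Real.zero_rpow hq1.ne']
    · rw [show q - 1 = q - 2 + 1 by ring, Real.rpow_add hx, Real.rpow_one]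
  have hFn : ∀ t v, ‖F t v‖ = S.indicator (fun t => (b t).toReal ^ e) t
      * B.indicator (fun v => ‖u t v‖ ^ (q - 1)) v := by
    intro t v
    simp only [hF, norm_mul, Complex.norm_real, Set.indicator]
    split_ifs
    · rw [← hpow _ (norm_nonneg _), Real.norm_of_nonneg (by positivity),
        Real.norm_of_nonneg (by positivity)]
      ring
    all_goals simp
  have hFe : ∀ t v, ‖F t v‖ₑ = S.indicator (fun t => b t ^ e) t
      * B.indicator (fun v => ‖u t v‖ₑ ^ (q - 1)) v := by
    intro t v
    rw [← ofReal_norm, hFn, Set.indicator, Set.indicator, Set.indicator, Set.indicator]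
    split_ifs with h1 h2
    · rw [ENNReal.ofReal_mul (by positivity), ← ENNReal.ofReal_rpow_of_nonneg (by positivity) hq1.le,
        ofReal_norm, ← ENNReal.ofReal_rpow_of_pos (ENNReal.toReal_pos (hb0 t h1) (hbt t)),
        ENNReal.ofReal_toReal (hbt t)]
    all_goals simp
  have hX : ∫⁻ s, ((∫⁻ v, ‖F s v‖ₑ ^ (q / (q - 1))) ^ ((q - 1) / q)) ^ (p / (p - 1)) = A := by
    refine lintegral_congr fun t => ?_
    simp only [hFe]
    by_cases ht : t ∈ S
    · rw [Set.indicator_of_mem ht, Set.indicator_of_mem ht]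
      have : ∀ v, (b t ^ e * B.indicator (fun v => ‖u t v‖ₑ ^ (q - 1)) v) ^ (q / (q - 1))
          = b t ^ (e * (q / (q - 1))) * B.indicator (fun v => ‖u t v‖ₑ ^ q) v := by
        intro v
        rw [ENNReal.mul_rpow_of_nonneg _ _ (by positivity), ← ENNReal.rpow_mul]
        congr 1
        simp only [Set.indicator]
        split_ifs
        · rw [← ENNReal.rpow_mul]
          congr 1
          field_simp
        · exact ENNReal.zero_rpow_of_pos (by positivity)
      simp only [this]
      rw [lintegral_const_mul' _ _ (ENNReal.rpow_ne_top_of_ne_zero (hb0 t ht) (hbt t)),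
        lintegral_indicator hBm]
      change ((b t ^ (e * (q / (q - 1))) * b t) ^ ((q - 1) / q)) ^ (p / (p - 1)) = _
      nth_rw 2 [← ENNReal.rpow_one (b t)]
      rw [← ENNReal.rpow_add _ _ (hb0 t ht) (hbt t), ← ENNReal.rpow_mul, ← ENNReal.rpow_mul]
      congr 1
      rw [he]
      field_simp
      ring
    · rw [Set.indicator_of_notMem ht, Set.indicator_of_notMem ht]
      simp [hp0, hp1, hq0, hq1, ENNReal.zero_rpow_of_pos]
  have hlin : ∫⁻ z : ℝ × (ℝ × ℝ), ‖u z.1 z.2‖ₑ * ‖F z.1 z.2‖ₑ = A := by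
    rw [Measure.volume_eq_prod, lintegral_prod (fun z : ℝ × (ℝ × ℝ) => ‖u z.1 z.2‖ₑ * ‖F z.1 z.2‖ₑ)
      (hu.enorm.mul hFm.enorm).aemeasurable]
    refine lintegral_congr fun t => ?_
    simp only [hFe]
    by_cases ht : t ∈ S
    · rw [Set.indicator_of_mem ht, Set.indicator_of_mem ht]
      have : ∀ v, ‖u t v‖ₑ * (b t ^ e * B.indicator (fun v => ‖u t v‖ₑ ^ (q - 1)) v)
          = b t ^ e * B.indicator (fun v => ‖u t v‖ₑ ^ q) v := by
        intro v
        rw [mul_left_comm]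
        congr 1
        simp only [Set.indicator]
        split_ifs
        · conv_rhs => rw [show q = 1 + (q - 1) by ring,
            ENNReal.rpow_add_of_nonneg _ _ zero_le_one hq1.le, ENNReal.rpow_one]
        · simp
      simp only [this]
      rw [lintegral_const_mul' _ _ (ENNReal.rpow_ne_top_of_ne_zero (hb0 t ht) (hbt t)),
        lintegral_indicator hBm]
      change b t ^ e * b t = _
      nth_rw 2 [← ENNReal.rpow_one (b t)]
      rw [← ENNReal.rpow_add _ _ (hb0 t ht) (hbt t)]
      congr 1
      rw [he]
      field_simp
      ring
    · rw [Set.indicator_of_notMem ht, Set.indicator_of_notMem ht]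
      simp
  have hInt : ‖∫ z : ℝ × (ℝ × ℝ), u z.1 z.2 * conj (F z.1 z.2)‖ₑ = A := by
    have e1 : ∀ z : ℝ × (ℝ × ℝ), u z.1 z.2 * conj (F z.1 z.2)
        = ((‖u z.1 z.2‖ * ‖F z.1 z.2‖ : ℝ) : ℂ) := by
      intro z
      have hc : 0 ≤ S.indicator (fun t => (b t).toReal ^ e) z.1
          * B.indicator (fun v => ‖u z.1 v‖ ^ (q - 2)) z.2 :=
        mul_nonneg (Set.indicator_nonneg (fun _ _ => by positivity) _)
          (Set.indicator_nonneg (fun _ _ => by positivity) _)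
      simp only [hF]
      rw [map_mul, Complex.conj_ofReal, mul_left_comm, Complex.mul_conj,
        Complex.normSq_eq_norm_sq, norm_mul, Complex.norm_real, Real.norm_of_nonneg hc]
      push_cast
      ring
    have e2 : ∀ z : ℝ × (ℝ × ℝ), ENNReal.ofReal (‖u z.1 z.2‖ * ‖F z.1 z.2‖)
        = ‖u z.1 z.2‖ₑ * ‖F z.1 z.2‖ₑ := by
      intro z
      rw [ENNReal.ofReal_mul (norm_nonneg _), ofReal_norm, ofReal_norm]
    have hnn : ∀ z : ℝ × (ℝ × ℝ), 0 ≤ ‖u z.1 z.2‖ * ‖F z.1 z.2‖ := fun z => by positivity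
    have hi : Integrable fun z : ℝ × (ℝ × ℝ) => ‖u z.1 z.2‖ * ‖F z.1 z.2‖ := by
      refine ⟨(hu.norm.mul hFm.norm).aestronglyMeasurable, ?_⟩
      rw [hasFiniteIntegral_iff_ofReal (Filter.Eventually.of_forall hnn)]
      simp only [e2, hlin]
      exact hAt.lt_top
    simp only [e1]
    rw [integral_complex_ofReal, ← ofReal_norm, Complex.norm_real,
      Real.norm_of_nonneg (integral_nonneg hnn),
      ofReal_integral_eq_lintegral_ofReal hi (Filter.Eventually.of_forall hnn)]
    simp only [e2, hlin]
  have key := h F ((ε ^ e + L.toReal ^ e) * M ^ (q - 1)) R hFm (fun t v => by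
    rw [hFn]
    have hbe : ∀ t ∈ S, (b t).toReal ^ e ≤ ε ^ e + L.toReal ^ e := by
      intro t ht
      have h1 : ε ≤ (b t).toReal := (ENNReal.ofReal_le_iff_le_toReal (hbt t)).1 ht.2
      have h2 : (b t).toReal ≤ L.toReal := ENNReal.toReal_mono hLt (hbL t)
      have h3 : 0 ≤ ε ^ e := by positivity
      have h4 : 0 ≤ L.toReal ^ e := by positivity
      rcases le_total 0 e with h0 | h0
      · have := Real.rpow_le_rpow (hε.le.trans h1) h2 h0
        linarith
      · have := Real.rpow_le_rpow_of_nonpos hε h1 h0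
        linarith
    by_cases ht : t ∈ S
    · rw [Set.indicator_of_mem ht, Set.indicator_of_mem (show t ∈ Set.Icc (-R) R from abs_le.1 ht.1)]
      by_cases hv : v ∈ B
      · rw [Set.indicator_of_mem hv, Set.indicator_of_mem hv, mul_one]
        gcongr
        · exact hbe t ht
        · exact hM t v
      · rw [Set.indicator_of_notMem hv, Set.indicator_of_notMem hv, mul_zero, mul_zero]
    · rw [Set.indicator_of_notMem ht, zero_mul]
      exact mul_nonneg (Set.indicator_nonneg (fun _ _ => by positivity) _)
          (Set.indicator_nonneg (fun _ _ => by positivity) _))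
  rw [hInt, hX] at key
  rcases eq_or_ne A 0 with hA0 | hA0
  · rw [hA0]; exact zero_le
  have hA1 : A ^ (1 / p) ≤ K := by
    have e3 : A = A ^ (1 / p) * A ^ ((p - 1) / p) := by
      rw [← ENNReal.rpow_add _ _ hA0 hAt, show 1 / p + (p - 1) / p = 1 by field_simp; ring,
        ENNReal.rpow_one]
    nth_rw 1 [e3] at key
    exact (ENNReal.mul_le_mul_iff_left (by simp [hA0, hAt])
      (ENNReal.rpow_ne_top_of_nonneg (by positivity) hAt)).1 key
  have := ENNReal.rpow_le_rpow hA1 hp0.le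
  rwa [← ENNReal.rpow_mul, one_div_mul_cancel hp0.ne', ENNReal.rpow_one] at this

open ComplexConjugate in
/-- Duality characterisation of the mixed norm `L^p_t L^q_x`, for bounded functions. -/
theorem lintegral_rpow_le_of_dual {u : ℝ → ℝ × ℝ → ℂ} (hu : Measurable (Function.uncurry u))
    {M : ℝ} (hM : ∀ t v, ‖u t v‖ ≤ M) {p q : ℝ} (hp : 1 < p) (hq : 1 < q) {K : ENNReal}
    (h : ∀ (F : ℝ → ℝ × ℝ → ℂ) (M R : ℝ), Measurable (Function.uncurry F) →
      (∀ s v, ‖F s v‖ ≤ (Set.Icc (-R) R).indicator (fun _ => M) s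
        * (Metric.closedBall 0 R).indicator (fun _ => 1) v) →
      ‖∫ z : ℝ × (ℝ × ℝ), u z.1 z.2 * conj (F z.1 z.2)‖ₑ
        ≤ K * (∫⁻ s, ((∫⁻ v, ‖F s v‖ₑ ^ (q / (q - 1))) ^ ((q - 1) / q))
          ^ (p / (p - 1))) ^ ((p - 1) / p)) :
    (∫⁻ t, (∫⁻ v, ‖u t v‖ₑ ^ q) ^ (p / q)) ^ (1 / p) ≤ K := by
  have hp0 : 0 < p := by linarith
  have hq0 : 0 < q := by linarith
  set b : ℕ → ℝ → ENNReal := fun N t =>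
    ∫⁻ v in Metric.closedBall (0 : ℝ × ℝ) N, ‖u t v‖ₑ ^ q with hb
  set S : ℕ → Set ℝ := fun N =>
    {t : ℝ | |t| ≤ N ∧ ENNReal.ofReal (1 / ((N : ℝ) + 1)) ≤ b N t} with hS
  have hbm : ∀ N, Measurable (b N) := fun N =>
    Measurable.lintegral_prod_right' (f := fun z : ℝ × (ℝ × ℝ) =>
      ‖Function.uncurry u z‖ₑ ^ q) (by fun_prop)
  have hSm : ∀ N, MeasurableSet (S N) := fun N =>
    MeasurableSet.inter (s₁ := {t : ℝ | |t| ≤ N}) (s₂ := {t | ENNReal.ofReal (1 / ((N : ℝ) + 1)) ≤ b N t})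
      (measurableSet_le measurable_norm measurable_const) (measurableSet_le measurable_const (hbm N))
  have hlim : ∀ t, Filter.Tendsto (fun N => b N t) Filter.atTop
      (nhds (∫⁻ v, ‖u t v‖ₑ ^ q)) := by
    intro t
    have hut : Measurable (u t) := hu.comp measurable_prodMk_left
    simp only [hb, ← lintegral_indicator measurableSet_closedBall]
    refine lintegral_tendsto_of_tendsto_of_monotone
      (fun N => ((hut.enorm.pow_const q).indicator measurableSet_closedBall).aemeasurable)
      (Filter.Eventually.of_forall fun v N N' hN => ?_) (Filter.Eventually.of_forall fun v => ?_)
    · exact Set.indicator_le_indicator_of_subset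
        (Metric.closedBall_subset_closedBall (by exact_mod_cast hN)) (fun _ => zero_le) v
    · refine tendsto_const_nhds.congr' ?_
      filter_upwards [Filter.eventually_ge_atTop ⌈‖v‖⌉₊] with N hN
      rw [Set.indicator_of_mem (mem_closedBall_zero_iff.2 (Nat.ceil_le.1 hN))]
  have key : ∫⁻ t, (∫⁻ v, ‖u t v‖ₑ ^ q) ^ (p / q) ≤ K ^ p := by
    calc ∫⁻ t, (∫⁻ v, ‖u t v‖ₑ ^ q) ^ (p / q)
        ≤ ∫⁻ t, Filter.liminf (fun N => (S N).indicator (fun t => b N t ^ (p / q)) t)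
            Filter.atTop := by
          refine lintegral_mono fun t => ?_
          rcases eq_or_ne (∫⁻ v, ‖u t v‖ₑ ^ q) 0 with h0 | h0
          · simp only [h0, ENNReal.zero_rpow_of_pos (div_pos hp0 hq0)]; exact zero_le
          have h1 := (ENNReal.continuous_rpow_const (y := p / q)).tendsto _ |>.comp (hlim t)
          refine (Filter.Tendsto.liminf_eq (h1.congr' ?_)).ge
          have h2 : Filter.Tendsto (fun N : ℕ => ENNReal.ofReal (1 / ((N : ℝ) + 1))) Filter.atTop
              (nhds 0) := by
            have := ENNReal.tendsto_ofReal (tendsto_one_div_add_atTop_nhds_zero_nat (𝕜 := ℝ))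
            rwa [ENNReal.ofReal_zero] at this
          filter_upwards [h2.eventually_lt (hlim t) (pos_iff_ne_zero.2 h0),
            Filter.eventually_ge_atTop ⌈|t|⌉₊] with N hN1 hN2
          have : t ∈ S N := ⟨Nat.ceil_le.1 hN2, hN1.le⟩
          rw [Set.indicator_of_mem this]
          rfl
      _ ≤ Filter.liminf (fun N => ∫⁻ t, (S N).indicator (fun t => b N t ^ (p / q)) t)
            Filter.atTop := lintegral_liminf_le fun N => ((hbm N).pow_const _).indicator (hSm N)
      _ ≤ K ^ p := by
          have hN : ∀ N : ℕ, ∫⁻ t, (S N).indicator (fun t => b N t ^ (p / q)) t ≤ K ^ p := fun N =>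
            lintegral_truncation_le_of_dual hu hM hp hq h (R := N)
              (ε := 1 / ((N : ℝ) + 1)) (by positivity)
          exact (Filter.liminf_le_liminf (Filter.Eventually.of_forall hN)).trans (by simp)
  have := ENNReal.rpow_le_rpow key (by positivity : 0 ≤ 1 / p)
  rwa [← ENNReal.rpow_mul, mul_one_div_cancel hp0.ne', ENNReal.rpow_one] at this

/-- Strichartz estimate for the linearized Novikov-Veselov equation:
`‖U_φ u₀‖_{L^p_t L^q_{xy}} ≲ ‖u₀‖_{L²}` for `p > 3`, `3/p + 2/q = 1`. -/
theorem strichartz_NV (p q : ℝ) (hp : 3 < p) (hpq : 3 / p + 2 / q = 1) :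
    ∃ C > (0 : ℝ), ∀ u₀ : SchwartzMap (ℝ × ℝ) ℂ,
      (∫⁻ t : ℝ, (∫⁻ v : ℝ × ℝ, (‖Uphi t u₀ v‖₊ : ENNReal) ^ q) ^ (p / q)) ^ (1 / p)
        ≤ ENNReal.ofReal C *
          (∫⁻ v : ℝ × ℝ, (‖u₀ v‖₊ : ENNReal) ^ (2 : ℝ)) ^ ((1 : ℝ) / 2) := by
  have hp0 : 0 < p := by linarith
  have h3p : 3 / p < 1 := by rwa [div_lt_one hp0]
  have h3p0 : 0 < 3 / p := by positivity
  have hq0 : 0 < q := by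
    by_contra h
    have := div_nonpos_of_nonneg_of_nonpos (zero_le_two (α := ℝ)) (not_lt.1 h)
    linarith
  have hq : 2 < q := by
    rw [← div_lt_one hq0]
    linarith
  have hexp : 2 / 3 * ((q - 2) / q) = 2 / p := by
    have h1 : (q - 2) / q = 1 - 2 / q := by field_simp
    rw [h1, ← hpq]
    ring
  obtain ⟨C, hC, hd⟩ := exists_enorm_integral_Uphi_mul_conj_le (by linarith) hq hexp
  refine ⟨C, hC, fun u₀ => ?_⟩
  have hum : Measurable u₀ := u₀.continuous.measurable
  have hui : Integrable u₀ := u₀.integrable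
  by_cases hFu : Integrable (FT2 u₀)
  · have := lintegral_rpow_le_of_dual (measurable_uncurry_Uphi hum)
      (fun t v => norm_Uphi_le t u₀ v) (p := p) (q := q) (by linarith) (by linarith)
      (fun F M R hF hb => hd u₀ hum hui hFu F M R hF hb)
    simp only [← ENNReal.rpow_two] at this
    exact this
  · simp only [Uphi_eq_zero_of_not_integrable hum hFu]
    simp [hq0, hp0, ENNReal.zero_rpow_of_pos]
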